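/- arXiv:2104.10101 — 3 statements merged into one kernel-verified Lean document; each statement's English description precedes it below -/
import Mathlib

section
/- Let α, β ∈ ℤ_{≥0}^n with [x^β]κ_α > 0, and suppose i < j with β_i < β_j − (j−i). Then [x^{t_{ij}β}]κ_α > 0. -/
open scoped Classical

namespace LSS

noncomputable section

open MvPolynomial

/-- The simple transposition `s_i ∈ S_n` (`1 ≤ i ≤ n-1`, 1-indexed): it exchanges the
letters `i` and `i+1` of `[n] = {1, …, n}`, realized on `Fin n` (0-indexed) as the swap
of `i-1` and `i`. For `i` out of range it is the identity. -/
def st (n : ℕ) (i : ℕ) : Equiv.Perm (Fin n) :=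
  if h : 0 < i ∧ i < n then Equiv.swap ⟨i - 1, by omega⟩ ⟨i, h.2⟩ else 1

/-- Coxeter length of `w ∈ S_n` = number of inversions. -/
def len (n : ℕ) (w : Equiv.Perm (Fin n)) : ℕ :=
  (Finset.univ.filter fun p : Fin n × Fin n => p.1 < p.2 ∧ w p.2 < w p.1).card

/-- `L` is a reduced word for `w`: a list of indices in `[n-1]` of length `ℓ(w)` whose
associated product of simple transpositions is `w`. -/
def IsRedWord (n : ℕ) (L : List ℕ) (w : Equiv.Perm (Fin n)) : Prop :=
  (∀ i ∈ L, 1 ≤ i ∧ i ≤ n - 1) ∧ (L.map (st n)).prod = w ∧ L.length = len n w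

/-- The left descent set `J(w) = {j ∈ [n-1] : ℓ(s_j w) < ℓ(w)}`. -/
def Descents (n : ℕ) (w : Equiv.Perm (Fin n)) : Set ℕ :=
  {j | 1 ≤ j ∧ j ≤ n - 1 ∧ len n (st n j * w) < len n w}

/-- The parabolic subgroup of `S_n` generated by `{s_i : i ∈ I}`. -/
def parab (n : ℕ) (I : Set ℕ) : Subgroup (Equiv.Perm (Fin n)) :=
  Subgroup.closure (st n '' I)

/-- `u = w_0(I)`, the longest element of the parabolic subgroup generated by `{s_i : i ∈ I}`. -/
def IsLongest (n : ℕ) (I : Set ℕ) (u : Equiv.Perm (Fin n)) : Prop :=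
  u ∈ parab n I ∧ ∀ v ∈ parab n I, len n v ≤ len n u

/-- `c` is a standard Coxeter element of some parabolic subgroup of `S_n`: a product of
the elements of some subset of `{s_1, …, s_{n-1}}`, each appearing exactly once, in some order. -/
def IsStdCox (n : ℕ) (c : Equiv.Perm (Fin n)) : Prop :=
  ∃ L : List ℕ, L.Nodup ∧ (∀ i ∈ L, 1 ≤ i ∧ i ≤ n - 1) ∧ (L.map (st n)).prod = c

/-- A weak composition `β : Fin n → ℕ` as an exponent vector. -/
def expOf (n : ℕ) (β : Fin n → ℕ) : Fin n →₀ ℕ := Finsupp.equivFunOnFinite.symm β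

/-- The monomial `x^β = x_1^{β_1} ⋯ x_n^{β_n}`. -/
def mono (n : ℕ) (β : Fin n → ℕ) : MvPolynomial (Fin n) ℤ := monomial (expOf n β) 1

/-- The coefficient `[x^β] f`. -/
def coeffOf (n : ℕ) (β : Fin n → ℕ) (f : MvPolynomial (Fin n) ℤ) : ℤ := coeff (expOf n β) f

/-- The isobaric divided difference (Demazure) operator
`π_i(f) = (x_i f − x_{i+1} s_i f)/(x_i − x_{i+1})` (1-indexed `i`), defined as the unique
polynomial `g` with `(x_i − x_{i+1})·g = x_i f − x_{i+1} s_i f`; such a `g` always exists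
and is unique since `ℤ[x_1,…,x_n]` is a domain. -/
def dem (n : ℕ) (i : ℕ) (f : MvPolynomial (Fin n) ℤ) : MvPolynomial (Fin n) ℤ :=
  if h : 0 < i ∧ i < n then
    if hg : ∃ g, (X (⟨i - 1, by omega⟩ : Fin n) - X (⟨i, h.2⟩ : Fin n)) * g =
        X (⟨i - 1, by omega⟩ : Fin n) * f -
          X (⟨i, h.2⟩ : Fin n) *
            rename (⇑(Equiv.swap (⟨i - 1, by omega⟩ : Fin n) (⟨i, h.2⟩ : Fin n))) f then
      hg.choose
    else 0
  else f

/-- `π_{i_1} π_{i_2} ⋯ π_{i_ℓ} (f)` for a word `L = [i_1, …, i_ℓ]`. -/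
def demWord (n : ℕ) (L : List ℕ) (f : MvPolynomial (Fin n) ℤ) : MvPolynomial (Fin n) ℤ :=
  L.foldr (dem n) f

/-- Entry accessor for a composition, 0-indexed position, default `0` out of range. -/
def ent (n : ℕ) (α : Fin n → ℕ) (p : ℕ) : ℕ := if h : p < n then α ⟨p, h⟩ else 0

/-- Exchange the entries of `α` in (0-indexed) positions `p` and `p+1`. -/
def swapAt (n : ℕ) (p : ℕ) (α : Fin n → ℕ) : Fin n → ℕ := fun m =>
  if (m : ℕ) = p then ent n α (p + 1) else if (m : ℕ) = p + 1 then ent n α p else α m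

/-- Auxiliary fuelled recursion computing the key polynomial `κ_α`:
if `α` is weakly decreasing, `κ_α = x^α`; otherwise, choosing an ascent `α_p < α_{p+1}`
(0-indexed `p`), `κ_α = π_{p+1}(κ_{α̂})` where `α̂` swaps the two entries.  The fuel
`n*n` in `keyPoly` strictly exceeds the number of co-inversions, which drops by one at
each step, so the recursion always terminates at a weakly decreasing composition. -/
def keyAux (n : ℕ) : ℕ → (Fin n → ℕ) → MvPolynomial (Fin n) ℤ
  | 0, α => mono n α
  | k + 1, α =>
    if h : ∃ p : Fin n, ent n α p.1 < ent n α (p.1 + 1) then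
      dem n (h.choose.1 + 1) (keyAux n k (swapAt n h.choose.1 α))
    else mono n α

/-- The key polynomial `κ_α`. -/
def keyPoly (n : ℕ) (α : Fin n → ℕ) : MvPolynomial (Fin n) ℤ := keyAux n (n * n) α

/-- `wλ`, the composition `(λ_{w⁻¹(1)}, …, λ_{w⁻¹(n)})`. -/
def pact (n : ℕ) (w : Equiv.Perm (Fin n)) (lam : Fin n → ℕ) : Fin n → ℕ :=
  fun i => lam (w⁻¹ i)

/-- `lam` is a partition (weakly decreasing vector) with at most `n` parts. -/
def IsPartition (n : ℕ) (lam : Fin n → ℕ) : Prop := ∀ i j : Fin n, i ≤ j → lam j ≤ lam i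

/-- Box `(c, r)` (column, row; both 1-indexed) belongs to the skyline diagram `D(α)`. -/
def InDiag (n : ℕ) (α : Fin n → ℕ) (c r : ℕ) : Prop :=
  1 ≤ c ∧ c ≤ n ∧ 1 ≤ r ∧ r ≤ ent n α (c - 1)

/-- `F` (value of box (column, row)) is a filling of `D(α)` that is flagged (labels in
column `c` are in `{1, …, c}`) and row distinct. -/
def IsTab (n : ℕ) (α : Fin n → ℕ) (F : ℕ → ℕ → ℕ) : Prop :=
  (∀ c r, InDiag n α c r → 1 ≤ F c r ∧ F c r ≤ c) ∧
  ∀ c c' r, InDiag n α c r → InDiag n α c' r → c ≠ c' → F c r ≠ F c' r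

/-- The weight of a filling: `wt(F)_i` = number of occurrences of the label `i`
(1-indexed; `Fin` position `i` records the label `i+1`). -/
def wt (n : ℕ) (α : Fin n → ℕ) (F : ℕ → ℕ → ℕ) : Fin n → ℕ := fun i =>
  ((Finset.Icc 1 n ×ˢ Finset.Icc 1 (Finset.univ.sup α)).filter fun p =>
    InDiag n α p.1 p.2 ∧ F p.1 p.2 = i.1 + 1).card

/-- `leftmin_α(i) = min{α_j : j ≤ i}`. -/
def leftmin (n : ℕ) (α : Fin n → ℕ) (i : Fin n) : ℕ := sInf (α '' {j | j ≤ i})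

/-- `rightmax_α(i) = max{α_j : j ≥ i}`. -/
def rightmax (n : ℕ) (α : Fin n → ℕ) (i : Fin n) : ℕ :=
  Finset.sup (Finset.univ.filter fun j => i ≤ j) α

/-- `d` records `0 = d_0 < d_1 < ⋯ < d_k < d_{k+1} = n`. -/
def BlockData (n k : ℕ) (d : Fin (k + 2) → ℕ) : Prop :=
  d 0 = 0 ∧ d (Fin.last (k + 1)) = n ∧ StrictMono d

/-- `D = {d_1, …, d_k}` as a set of natural numbers. -/
def Dset (k : ℕ) (d : Fin (k + 2) → ℕ) : Set ℕ :=
  {m | ∃ t : Fin (k + 2), t ≠ 0 ∧ t ≠ Fin.last (k + 1) ∧ d t = m}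

/-- `I = [n−1] ∖ D`. -/
def Iset (n k : ℕ) (d : Fin (k + 2) → ℕ) : Set ℕ :=
  {m | 1 ≤ m ∧ m ≤ n - 1 ∧ m ∉ Dset k d}

/-- Positions `i, j` (of `Fin n`, 0-indexed; 1-indexed letters `i+1, j+1`) lie in the same
block: some `t` has `d_t < i+1, j+1 ≤ d_{t+1}`. -/
def SameBlock (n k : ℕ) (d : Fin (k + 2) → ℕ) (i j : Fin n) : Prop :=
  ∃ t : Fin (k + 1), d t.castSucc ≤ i.1 ∧ i.1 < d t.succ ∧ d t.castSucc ≤ j.1 ∧ j.1 < d t.succ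

/-- The variables `X_t = {x_{d_t + 1}, …, x_{d_{t+1}}}` of the `t`-th block. -/
def blockVars (n k : ℕ) (d : Fin (k + 2) → ℕ) (t : Fin (k + 1)) : Finset (Fin n) :=
  Finset.univ.filter fun p => d t.castSucc ≤ p.1 ∧ p.1 < d t.succ

/-- Complete homogeneous symmetric polynomial of degree `m` in the variables `S`. -/
def hPoly (n : ℕ) (S : Finset (Fin n)) (m : ℕ) : MvPolynomial (Fin n) ℤ :=
  ∑ f ∈ S.sym m, ((f : Multiset (Fin n)).map X).prod

/-- `h_z` for `z : ℤ`, with `h_z = 0` for `z < 0`. -/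
def hZ (n : ℕ) (S : Finset (Fin n)) (z : ℤ) : MvPolynomial (Fin n) ℤ :=
  if 0 ≤ z then hPoly n S z.toNat else 0

/-- The Schur polynomial `s_lam` in the variable set `S`, for a partition `lam`
(1-indexed parts, at most `t` of them), via the Jacobi–Trudi determinant
`det(h_{lam_i − i + j})_{1 ≤ i,j ≤ t}`. -/
def schurP (n : ℕ) (S : Finset (Fin n)) (t : ℕ) (lam : ℕ → ℕ) : MvPolynomial (Fin n) ℤ :=
  (Matrix.of fun i j : Fin t =>
    hZ n S ((lam (i.1 + 1) : ℤ) - (i.1 + 1) + (j.1 + 1))).det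

/-- `γ ∈ Par_D`: a `(k+1)`-tuple of partitions, the `t`-th having at most
`d_{t+1} − d_t` nonzero parts (1-indexed parts; the unused index `0` is normalized to `0`). -/
def ParD (k : ℕ) (d : Fin (k + 2) → ℕ) (γ : Fin (k + 1) → ℕ → ℕ) : Prop :=
  ∀ t : Fin (k + 1), γ t 0 = 0 ∧ (∀ a b : ℕ, 1 ≤ a → a ≤ b → γ t b ≤ γ t a) ∧
    ∀ m : ℕ, d t.succ - d t.castSucc < m → γ t m = 0

/-- The `D`-Schur polynomial `s_{γ^1,…,γ^{k+1}} = ∏_t s_{γ^t}(X_t)`. -/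
def dSchur (n k : ℕ) (d : Fin (k + 2) → ℕ) (γ : Fin (k + 1) → ℕ → ℕ) :
    MvPolynomial (Fin n) ℤ :=
  ∏ t : Fin (k + 1), schurP n (blockVars n k d t) (d t.succ - d t.castSucc) (γ t)

/-- Truncation of an integer vector to a natural-number vector. -/
def toNatV (n : ℕ) (β : Fin n → ℤ) : Fin n → ℕ := fun i => (β i).toNat

/-- `j − i` as an integer. -/
def gapZ (n : ℕ) (i j : Fin n) : ℤ := (j.1 : ℤ) - (i.1 : ℤ)

/-- The move `t_{ij}`: replace `β_i` by `β_j − (j−i)` and `β_j` by `β_i + (j−i)`. -/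
def tmv (n : ℕ) (i j : Fin n) (β : Fin n → ℤ) : Fin n → ℤ := fun m =>
  if m = i then β j - gapZ n i j else if m = j then β i + gapZ n i j else β m

/-- The rank `θ(β) = #{(a,b) : a < b in the same block and β_a < β_b − (b−a)}`. -/
def theta (n k : ℕ) (d : Fin (k + 2) → ℕ) (β : Fin n → ℤ) : ℕ :=
  (Finset.univ.filter fun p : Fin n × Fin n =>
    p.1 < p.2 ∧ SameBlock n k d p.1 p.2 ∧ β p.1 < β p.2 - gapZ n p.1 p.2).card

/-- One step up in the Bruhat-type order: `β ⋖ t_{ij} β` whenever `i < j` are in the same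
block and `β_i > β_j − (j−i)`. -/
def stepUp (n k : ℕ) (d : Fin (k + 2) → ℕ) (β β' : Fin n → ℤ) : Prop :=
  ∃ i j : Fin n, i < j ∧ SameBlock n k d i j ∧ β j - gapZ n i j < β i ∧ β' = tmv n i j β

/-- The order on compositions: transitive (reflexive) closure of `stepUp`. -/
def leB (n k : ℕ) (d : Fin (k + 2) → ℕ) : (Fin n → ℤ) → (Fin n → ℤ) → Prop :=
  Relation.ReflTransGen (stepUp n k d)

/-- Membership in the poset `P_{α,γ}` (for `α = cλ`): `β` is a weak composition with
`[x^β] κ_α ≠ 0` and `π_{w_0(I)}(x^β) = ± s_γ`. -/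
def memP (n k : ℕ) (d : Fin (k + 2) → ℕ) (w0I : Equiv.Perm (Fin n)) (α : Fin n → ℕ)
    (γ : Fin (k + 1) → ℕ → ℕ) (β : Fin n → ℤ) : Prop :=
  (∀ i, 0 ≤ β i) ∧ coeffOf n (toNatV n β) (keyPoly n α) ≠ 0 ∧
  ∃ L, IsRedWord n L w0I ∧
    (demWord n L (mono n (toNatV n β)) = dSchur n k d γ ∨
     demWord n L (mono n (toNatV n β)) = -dSchur n k d γ)

/-- The pair `i < j` is interweaved for `α`: `α_m ≥ α_{m+1}` for `i ≤ m < j`,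
`leftmin_α(i) < α_i` and `rightmax_α(j) > α_j`. -/
def Interweaved (n : ℕ) (α : Fin n → ℕ) (i j : Fin n) : Prop :=
  i < j ∧ (∀ p : Fin n, i ≤ p → p < j → ent n α (p.1 + 1) ≤ α p) ∧
  leftmin n α i < α i ∧ α j < rightmax n α j

/-- `center_α(i,j) = max{m : i ≤ m ≤ j and α_m ≥ rightmax_α(j)}` (as a 0-indexed position). -/
def center (n : ℕ) (α : Fin n → ℕ) (i j : Fin n) : ℕ :=
  Finset.sup (Finset.univ.filter fun p : Fin n => i ≤ p ∧ p ≤ j ∧ rightmax n α j ≤ α p)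
    fun p => p.1

/-- Partial sum `β_1 + ⋯ + β_{m+1}` (0-indexed positions `≤ m`) of an integer vector. -/
def psumZ (n : ℕ) (β : Fin n → ℤ) (m : ℕ) : ℤ :=
  ∑ p ∈ Finset.univ.filter (fun p : Fin n => p.1 ≤ m), β p

/-- Partial sum of a composition, as an integer. -/
def psumN (n : ℕ) (α : Fin n → ℕ) (m : ℕ) : ℤ :=
  ∑ p ∈ Finset.univ.filter (fun p : Fin n => p.1 ≤ m), (α p : ℤ)

/-- Composition pattern containment. -/
def ContainsPat (n : ℕ) {m : ℕ} (α : Fin n → ℕ) (pat : Fin m → ℕ) : Prop :=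
  ∃ g : Fin m → Fin n, StrictMono g ∧
    (∀ s t : Fin m, pat s ≤ pat t ↔ α (g s) ≤ α (g t)) ∧
    ∀ s t : Fin m, |(pat s : ℤ) - (pat t : ℤ)| ≤ |(α (g s) : ℤ) - (α (g t) : ℤ)|

end

end LSS
namespace LSS
namespace KeySupp
noncomputable section

/-- Exponent vectors indexed by all integers. -/
abbrev Ex := ℤ → ℤ
/-- The Laurent-type group ring. -/
abbrev GR := AddMonoidAlgebra ℤ Ex

def mon (β : Ex) : GR := AddMonoidAlgebra.single β 1

lemma mon_mul (β γ : Ex) : mon β * mon γ = mon (β + γ) := by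
  simp [mon, AddMonoidAlgebra.single_mul_single]

lemma mon_coeff (β γ : Ex) : (mon β).coeff γ = if β = γ then 1 else 0 := by
  simp [mon, Finsupp.single_apply]

lemma hom_ext {N : Type*} [AddCommGroup N] {f g : GR →+ N} (h : ∀ β, f (mon β) = g (mon β)) :
    f = g := by
  apply AddMonoidAlgebra.addMonoidHom_ext
  intro β r
  have : (AddMonoidAlgebra.single β r : GR) = r • mon β := by
    simp [mon, AddMonoidAlgebra.smul_single]
  rw [this, map_zsmul, map_zsmul, h]

/-- Operator defined on the monomial basis. -/
def opOf (g : Ex → GR) : AddMonoid.End GR where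
  toFun x := x.coeff.sum fun m r => r • g m
  map_zero' := by simp
  map_add' x y := by
    rw [AddMonoidAlgebra.coeff_add]
    exact Finsupp.sum_add_index' (h := fun m (r : ℤ) => r • g m) (by simp)
      (fun m a b => add_smul a b (g m))

lemma opOf_mon (g : Ex → GR) (β : Ex) : opOf g (mon β) = g β := by
  show (mon β).coeff.sum (fun m (r : ℤ) => r • g m) = g β
  simp [mon]

/-- Simple root. -/
def rt (p : ℤ) : Ex := fun i => if i = p then 1 else if i = p + 1 then -1 else 0

lemma rt_self (p : ℤ) : rt p p = 1 := by simp [rt]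
lemma rt_succ (p : ℤ) : rt p (p + 1) = -1 := by simp [rt]
lemma rt_other (p i : ℤ) (h : i ≠ p) (h' : i ≠ p + 1) : rt p i = 0 := by simp [rt, h, h']

def strg (p : ℤ) (β : Ex) : GR :=
  if β (p + 1) ≤ β p then
    ∑ t ∈ Finset.range (β p - β (p + 1) + 1).toNat, mon (β - (t : ℤ) • rt p)
  else - ∑ t ∈ Finset.range (β (p + 1) - β p - 1).toNat, mon (β + ((t : ℤ) + 1) • rt p)

/-- Demazure operator. -/
def dm (p : ℤ) : AddMonoid.End GR := opOf (strg p)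

def swE (p : ℤ) : Ex →+ Ex where
  toFun β := fun i => β (Equiv.swap p (p + 1) i)
  map_zero' := rfl
  map_add' _ _ := rfl

lemma swE_eq (p : ℤ) (β : Ex) : swE p β = β - (β p - β (p + 1)) • rt p := by
  funext i
  show β (Equiv.swap p (p + 1) i) = _
  by_cases h : i = p
  · subst h; simp [rt_self]
  by_cases h' : i = p + 1
  · subst h'; simp [rt_succ]
  rw [Equiv.swap_apply_of_ne_of_ne h h']; simp [rt_other p i h h']

def sw (p : ℤ) : GR →+* GR := AddMonoidAlgebra.mapDomainRingHom ℤ (swE p)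

lemma sw_mon (p : ℤ) (β : Ex) : sw p (mon β) = mon (swE p β) := by
  simp [sw, mon]

lemma tele (v β : Ex) (k : ℕ) :
    (1 - mon (-v)) * ∑ t ∈ Finset.range k, mon (β - (t : ℤ) • v) = mon β - mon (β - (k : ℤ) • v) := by
  induction k with
  | zero => simp
  | succ k ih =>
    rw [Finset.sum_range_succ, mul_add, ih, sub_mul, one_mul, mon_mul]
    have : -v + (β - (k : ℤ) • v) = β - ((k + 1 : ℕ) : ℤ) • v := by
      push_cast; rw [add_smul, one_smul]; abel
    rw [this]; abel

lemma dm_rel (p : ℤ) (f : GR) : (1 - mon (-rt p)) * dm p f = f - mon (-rt p) * sw p f := by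
  have key : (AddMonoidHom.mulLeft (1 - mon (-rt p))).comp (dm p) =
      AddMonoidHom.id GR - (AddMonoidHom.mulLeft (mon (-rt p))).comp (sw p).toAddMonoidHom := by
    apply hom_ext
    intro β
    show (1 - mon (-rt p)) * dm p (mon β) = mon β - mon (-rt p) * sw p (mon β)
    rw [dm, opOf_mon, sw_mon, swE_eq, mon_mul, strg]
    split_ifs with h
    · rw [tele]
      congr 2
      have : (((β p - β (p + 1) + 1).toNat : ℕ) : ℤ) = β p - β (p + 1) + 1 := by omega
      rw [this, add_smul, one_smul]; abel
    · obtain ⟨k, hk⟩ : ∃ k : ℕ, β (p + 1) - β p - 1 = k := ⟨(β (p + 1) - β p - 1).toNat, by omega⟩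
      have e : ∑ t ∈ Finset.range (β (p + 1) - β p - 1).toNat, mon (β + ((t : ℤ) + 1) • rt p) =
          ∑ t ∈ Finset.range k, mon ((β + (k : ℤ) • rt p) - (t : ℤ) • rt p) := by
        rw [hk, Int.toNat_natCast, ← Finset.sum_range_reflect]
        apply Finset.sum_congr rfl
        intro t ht
        rw [Finset.mem_range] at ht
        congr 1
        rw [add_sub_assoc, ← sub_smul]
        congr 2
        omega
      rw [mul_neg, e, tele, neg_sub]
      congr 2
      · abel
      · have : β p - β (p + 1) = -(k : ℤ) - 1 := by omega
        rw [this, sub_smul, neg_smul, one_smul]; abel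
  exact DFunLike.congr_fun key f

lemma D_ne (v : Ex) (h : v ≠ 0) : (1 - mon v : GR) ≠ 0 := by
  intro h0
  have : (1 : GR) = mon v := sub_eq_zero.mp h0
  have := congrArg (fun x => x.coeff v) this
  simp [mon_coeff, AddMonoidAlgebra.one_def, h.symm] at this

lemma rt_ne (p : ℤ) : -rt p ≠ 0 := by
  intro h
  have := congrFun h p
  simp [rt_self] at this

lemma sw_sw (p : ℤ) (f : GR) : sw p (sw p f) = f := by
  have key : ((sw p).comp (sw p)).toAddMonoidHom = AddMonoidHom.id GR := by
    apply hom_ext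
    intro β
    show sw p (sw p (mon β)) = mon β
    rw [sw_mon, sw_mon]
    congr 1
    funext i
    simp [swE]
  exact DFunLike.congr_fun key f

lemma sw_rt (p : ℤ) : swE p (-rt p) = rt p := by
  rw [swE_eq]; simp [rt_self, rt_succ]; ring

lemma mon_inv (v : Ex) : mon v * mon (-v) = 1 := by
  rw [mon_mul, add_neg_cancel]; rfl

lemma sw_dm (p : ℤ) (f : GR) : sw p (dm p f) = dm p f := by
  apply mul_left_cancel₀ (D_ne _ (rt_ne p))
  have h := congrArg (sw p) (dm_rel p f)
  simp only [map_sub, map_mul, map_one, sw_mon, sw_rt, sw_sw] at h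
  have h2 := dm_rel p f
  have h3 := mon_inv (rt p)
  linear_combination (- mon (-rt p)) * h + (-h2) - (sw p (dm p f) - f) * h3

lemma dm_eq_of (p : ℤ) (f g : GR) (h : (1 - mon (-rt p)) * g = f - mon (-rt p) * sw p f) :
    g = dm p f := by
  apply mul_left_cancel₀ (D_ne _ (rt_ne p))
  rw [h, dm_rel]

lemma dm_idem (p : ℤ) : dm p * dm p = dm p := by
  ext1 f
  show dm p (dm p f) = dm p f
  symm
  apply dm_eq_of
  rw [sw_dm]; ring

lemma sw_comm (p q : ℤ) (h : p + 1 < q) (f : GR) : sw p (sw q f) = sw q (sw p f) := by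
  have key : ((sw p).comp (sw q)).toAddMonoidHom = ((sw q).comp (sw p)).toAddMonoidHom := by
    apply hom_ext
    intro β
    show sw p (sw q (mon β)) = sw q (sw p (mon β))
    simp only [sw_mon]
    congr 1
    funext i
    simp only [swE, AddMonoidHom.coe_mk, ZeroHom.coe_mk, Equiv.swap_apply_def]
    congr 1
    split_ifs <;> omega
  exact DFunLike.congr_fun key f

lemma swE_far (p q : ℤ) (h : p + 1 < q ∨ q + 1 < p) : swE p (-rt q) = -rt q := by
  rw [swE_eq]
  simp [rt_other q p (by omega) (by omega), rt_other q (p+1) (by omega) (by omega)]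

lemma dm_comm (p q : ℤ) (h : p + 1 < q) : dm p * dm q = dm q * dm p := by
  ext1 f
  show dm p (dm q f) = dm q (dm p f)
  apply mul_left_cancel₀ (D_ne _ (rt_ne p))
  apply mul_left_cancel₀ (D_ne _ (rt_ne q))
  have a1 := dm_rel p (dm q f)
  have a2 := dm_rel q f
  have a3 := congrArg (sw p) a2
  have b1 := dm_rel q (dm p f)
  have b2 := dm_rel p f
  have b3 := congrArg (sw q) b2
  simp only [map_sub, map_mul, map_one, sw_mon, swE_far p q (Or.inl h), swE_far q p (Or.inr h)]
    at a3 b3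
  have c := sw_comm p q h f
  linear_combination (1 - mon (-rt q)) * a1 + a2 - mon (-rt p) * a3
    - ((1 - mon (-rt p)) * b1 + b2 - mon (-rt q) * b3) + (mon (-rt p) * mon (-rt q)) * c

lemma sw_braid (p : ℤ) (f : GR) :
    sw p (sw (p + 1) (sw p f)) = sw (p + 1) (sw p (sw (p + 1) f)) := by
  have key : ((sw p).comp ((sw (p+1)).comp (sw p))).toAddMonoidHom =
      ((sw (p+1)).comp ((sw p).comp (sw (p+1)))).toAddMonoidHom := by
    apply hom_ext
    intro β
    show sw p (sw (p + 1) (sw p (mon β))) = sw (p + 1) (sw p (sw (p + 1) (mon β)))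
    simp only [sw_mon]
    congr 1
    funext i
    simp only [swE, AddMonoidHom.coe_mk, ZeroHom.coe_mk, Equiv.swap_apply_def]
    congr 1
    split_ifs <;> omega
  exact DFunLike.congr_fun key f

lemma swE_adj (p : ℤ) : swE p (-rt (p + 1)) = -rt p + -rt (p + 1) := by
  rw [swE_eq]
  simp [rt_other (p+1) p (by omega) (by omega), rt_self]
  abel

lemma swE_adj' (p : ℤ) : swE (p + 1) (-rt p) = -rt p + -rt (p + 1) := by
  rw [swE_eq]
  simp [rt_other p (p+1+1) (by omega) (by omega), rt_succ]
  abel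

lemma dm_braid (p : ℤ) : dm p * dm (p + 1) * dm p = dm (p + 1) * dm p * dm (p + 1) := by
  ext1 f
  show dm p (dm (p + 1) (dm p f)) = dm (p + 1) (dm p (dm (p + 1) f))
  have hab : -rt p + -rt (p + 1) ≠ 0 := by
    intro h
    have := congrFun h p
    simp [rt_self, rt_other (p+1) p (by omega) (by omega)] at this
  have hsa : swE p (-rt p + -rt (p + 1)) = -rt (p + 1) := by
    rw [map_add, swE_adj, sw_rt]; abel
  have hsb : swE (p + 1) (-rt p + -rt (p + 1)) = -rt p := by
    rw [map_add, swE_adj', sw_rt]; abel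
  apply mul_left_cancel₀ (D_ne _ (rt_ne p))
  apply mul_left_cancel₀ (D_ne _ (rt_ne (p + 1)))
  apply mul_left_cancel₀ (D_ne _ hab)
  have a1 := dm_rel p (dm (p + 1) (dm p f))
  have a2 := dm_rel (p + 1) (dm p f)
  have a3 := congrArg (sw p) a2
  have a4 := dm_rel p f
  have a5 := congrArg (sw (p + 1)) a4
  have a6 := congrArg (sw p) a5
  have b1 := dm_rel (p + 1) (dm p (dm (p + 1) f))
  have b2 := dm_rel p (dm (p + 1) f)
  have b3 := congrArg (sw (p + 1)) b2
  have b4 := dm_rel (p + 1) f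
  have b5 := congrArg (sw p) b4
  have b6 := congrArg (sw (p + 1)) b5
  simp only [map_sub, map_mul, map_one, sw_mon, swE_adj, swE_adj', sw_dm, hsa, hsb]
    at a3 a5 a6 b3 b5 b6
  have c := sw_braid p f
  have hm := mon_mul (-rt p) (-rt (p + 1))
  rw [← hm] at a3 a5 b3 b5 ⊢
  generalize mon (-rt p) = a at *
  generalize mon (-rt (p + 1)) = b at *
  linear_combination (1 - b) * (1 - a * b) * a1 + (1 - a * b) * a2 - a * (1 - b) * a3
    + a4 - b * a5 + a * (a * b) * a6
    - ((1 - a) * (1 - a * b) * b1 + (1 - a * b) * b2 - b * (1 - a) * b3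
    + b4 - a * b5 + b * (a * b) * b6) - a ^ 2 * b ^ 2 * c

end
end KeySupp
end LSS

namespace LSS
namespace KeySupp
noncomputable section

section NF
variable {M : Type*} [Monoid M] (x : ℤ → M)

/-- `x (k+m-1) * ... * x k`. -/
def cc (k : ℤ) : ℕ → M
  | 0 => 1
  | m + 1 => x (k + m) * cc k m

def Wd (a b : ℤ) : Submonoid M := Submonoid.closure {y | ∃ p, a ≤ p ∧ p < b ∧ y = x p}

lemma x_mem_Wd {a b p : ℤ} (h : a ≤ p) (h' : p < b) : x p ∈ Wd x a b :=
  Submonoid.subset_closure ⟨p, h, h', rfl⟩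

lemma Wd_mono {a b a' b' : ℤ} (h : a' ≤ a) (h' : b ≤ b') : Wd x a b ≤ Wd x a' b' := by
  apply Submonoid.closure_mono
  rintro y ⟨p, h1, h2, rfl⟩
  exact ⟨p, by omega, by omega, rfl⟩

lemma cc_mem {a b k : ℤ} (m : ℕ) (h : a ≤ k) (h' : k + m ≤ b) : cc x k m ∈ Wd x a b := by
  induction m with
  | zero => exact one_mem _
  | succ m ih =>
    push_cast at h'
    exact mul_mem (x_mem_Wd x (by omega) (by omega)) (ih (by omega))

lemma cc_split (k : ℤ) (m n : ℕ) : cc x k (m + n) = cc x (k + m) n * cc x k m := by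
  induction n with
  | zero => simp [cc]
  | succ n ih =>
    rw [← add_assoc, cc, cc, ih, mul_assoc]
    push_cast
    rw [add_assoc]

lemma cc_succ' (k : ℤ) (m : ℕ) : cc x k (m + 1) = cc x (k + 1) m * x k := by
  have := cc_split x k 1 m
  rw [add_comm 1 m] at this
  rw [this]
  simp [cc]


lemma Wd_comm
    (hC : ∀ p q, p + 1 < q → x p * x q = x q * x p)
    {a b c d : ℤ} (h : b < c) {u v : M} (hu : u ∈ Wd x a b) (hv : v ∈ Wd x c d) :
    u * v = v * u := by
  have h1 : ∀ p, c ≤ p → ∀ w ∈ Wd x a b, w * x p = x p * w := by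
    intro p hp w hw
    induction hw using Submonoid.closure_induction with
    | mem y hy => obtain ⟨q, h1, h2, rfl⟩ := hy; exact hC q p (by omega)
    | one => simp
    | mul y z _ _ hy hz => rw [mul_assoc, hz, ← mul_assoc, hy, mul_assoc]
  induction hv using Submonoid.closure_induction with
  | mem y hy => obtain ⟨q, h1', h2, rfl⟩ := hy; exact h1 q h1' u hu
  | one => simp
  | mul y z _ _ hy hz => rw [← mul_assoc, hy, mul_assoc, hz, mul_assoc]

lemma cc_shift
    (hC : ∀ p q, p + 1 < q → x p * x q = x q * x p)
    (hB : ∀ p, x p * x (p + 1) * x p = x (p + 1) * x p * x (p + 1))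
    (k q : ℤ) (m : ℕ) (h : k ≤ q) (h' : q + 1 < k + m) :
    x q * cc x k m = cc x k m * x (q + 1) := by
  induction m with
  | zero => push_cast at h'; omega
  | succ m ih =>
    push_cast at h'
    rw [cc]
    by_cases h2 : q + 1 < k + m
    · rw [← mul_assoc, hC q (k + m) h2, mul_assoc, ih h2, mul_assoc]
    · obtain ⟨n, rfl⟩ : ∃ n, m = n + 1 := ⟨m - 1, by omega⟩
      obtain rfl : q = k + n := by omega
      have e : k + ((n + 1 : ℕ) : ℤ) = k + n + 1 := by push_cast; ring
      rw [cc, e]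
      have hc : cc x k n * x (k + n + 1) = x (k + n + 1) * cc x k n :=
        Wd_comm x hC (a := k) (b := k + n) (c := k + n + 1) (d := k + n + 2) (by omega)
          (cc_mem x n le_rfl le_rfl) (x_mem_Wd x le_rfl (by omega))
      calc _ = (x (k + n) * x (k + n + 1) * x (k + n)) * cc x k n := by simp only [mul_assoc]
        _ = x (k + n + 1) * x (k + n) * (x (k + n + 1) * cc x k n) := by rw [hB]; simp only [mul_assoc]
        _ = _ := by rw [← hc]; simp only [mul_assoc]

lemma cc_shifts
    (hC : ∀ p q, p + 1 < q → x p * x q = x q * x p)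
    (hB : ∀ p, x p * x (p + 1) * x p = x (p + 1) * x p * x (p + 1))
    (k l : ℤ) (m n : ℕ) (h : k ≤ l) (h' : l + n + 1 ≤ k + m) :
    cc x l n * cc x k m = cc x k m * cc x (l + 1) n := by
  induction n with
  | zero => simp [cc]
  | succ n ih =>
    push_cast at h'
    rw [cc, cc, mul_assoc, ih (by omega), ← mul_assoc, cc_shift x hC hB k _ m (by omega) (by omega),
      mul_assoc]
    congr 3; ring

lemma cc_idem
    (hI : ∀ p, x p * x p = x p)
    (k : ℤ) (m : ℕ) : x (k + m) * cc x k (m + 1) = cc x k (m + 1) := by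
  rw [cc, ← mul_assoc, hI]

lemma cc_cc
    (hI : ∀ p, x p * x p = x p)
    (hC : ∀ p q, p + 1 < q → x p * x q = x q * x p)
    (hB : ∀ p, x p * x (p + 1) * x p = x (p + 1) * x p * x (p + 1))
    (a k l : ℤ) (m n : ℕ) (hk : a ≤ k) (hl : a ≤ l) (h : l + n + 1 = k + m) :
    ∃ v ∈ Wd x a (k + m - 1), ∃ k' : ℤ, ∃ m' : ℕ, a ≤ k' ∧ k' + m' = k + m ∧
      cc x l (n + 1) * cc x k m = v * cc x k' m' := by
  rcases m with _ | m
  · refine ⟨1, one_mem _, l, n + 1, hl, by push_cast at *; omega, ?_⟩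
    simp [cc]
  push_cast at h
  by_cases hkl : k ≤ l
  · refine ⟨cc x l n, cc_mem x n hl (by push_cast; omega), k, m + 1, hk, rfl, ?_⟩
    have e : l + n = k + m := by omega
    rw [cc, mul_assoc, cc_shifts x hC hB k l (m + 1) n hkl (by push_cast; omega), ← mul_assoc, e,
      cc_idem x hI]
  · obtain ⟨d, hd⟩ : ∃ d : ℕ, k = l + d + 1 := ⟨(k - l - 1).toNat, by omega⟩
    have hn : n + 1 = (d + 1) + (m + 1) := by omega
    have hkd : l + ((d + 1 : ℕ) : ℤ) = k := by push_cast; omega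
    have s1 : cc x l (n + 1) = cc x k (m + 1) * cc x l (d + 1) := by
      rw [hn, cc_split, hkd]
    refine ⟨cc x k m * x (k - 1), mul_mem (cc_mem x m hk (by push_cast; omega))
      (x_mem_Wd x (by omega) (by push_cast; omega)), l, n + 1, hl, by push_cast; omega, ?_⟩
    have c1 : cc x l (d + 1) * cc x (k + 1) m = cc x (k + 1) m * cc x l (d + 1) :=
      Wd_comm x hC (a := l) (b := k) (c := k + 1) (d := k + 1 + m) (by omega)
        (cc_mem x _ le_rfl hkd.le) (cc_mem x _ le_rfl le_rfl)
    have c2 := cc_shifts x hC hB k k (m + 1) m le_rfl (by push_cast; omega)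
    have c3 := cc_shift x hC hB l (k - 1) (n + 1) (by omega) (by push_cast; omega)
    rw [sub_add_cancel] at c3
    calc cc x l (n + 1) * cc x k (m + 1)
        = cc x k (m + 1) * (cc x l (d + 1) * cc x (k + 1) m) * x k := by
          rw [s1, cc_succ' x k m]; simp only [mul_assoc]
      _ = (cc x k (m + 1) * cc x (k + 1) m) * cc x l (d + 1) * x k := by
          rw [c1]; simp only [mul_assoc]
      _ = cc x k m * (cc x l (n + 1) * x k) := by rw [← c2, s1]; simp only [mul_assoc]
      _ = _ := by rw [← c3]; simp only [mul_assoc]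

lemma normal_form
    (hI : ∀ p, x p * x p = x p)
    (hC : ∀ p q, p + 1 < q → x p * x q = x q * x p)
    (hB : ∀ p, x p * x (p + 1) * x p = x (p + 1) * x p * x (p + 1))
    (a : ℤ) (N : ℕ) : ∀ w ∈ Wd x a (a + N), ∃ u ∈ Wd x a (a + N - 1),
    ∃ k : ℤ, ∃ m : ℕ, a ≤ k ∧ k + m = a + N ∧ w = u * cc x k m := by
  induction N with
  | zero =>
    intro w hw
    have : w = 1 := by
      induction hw using Submonoid.closure_induction with
      | mem y hy => obtain ⟨q, h1, h2, rfl⟩ := hy; push_cast at h2; omega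
      | one => rfl
      | mul y z _ _ hy hz => rw [hy, hz, one_mul]
    exact ⟨1, one_mem _, a, 0, le_rfl, by simp, by simp [this, cc]⟩
  | succ N ih =>
    intro w hw
    induction hw using Submonoid.closure_induction_left with
    | one => exact ⟨1, one_mem _, a + (N + 1 : ℕ), 0, by omega, by simp, by simp [cc]⟩
    | mul_left y hy w _ hw =>
      obtain ⟨q, h1, h2, rfl⟩ := hy
      obtain ⟨u, hu, k, m, hk, hkm, rfl⟩ := hw
      push_cast at h2 hu hkm ⊢
      by_cases hq : q < a + N
      · exact ⟨x q * u, mul_mem (x_mem_Wd x h1 (by omega)) hu, k, m, hk, hkm, by rw [mul_assoc]⟩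
      obtain rfl : q = a + N := by omega
      rw [show a + ((N : ℤ) + 1) - 1 = a + N by ring] at hu ⊢
      obtain ⟨u', hu', l, n, hl, hln, rfl⟩ := ih u hu
      obtain ⟨v, hv, k', m', hk', hkm', e⟩ := cc_cc x hI hC hB a k l m n hk hl (by omega)
      refine ⟨u' * v, mul_mem (Wd_mono x le_rfl (by omega) hu') (Wd_mono x le_rfl (by omega) hv),
        k', m', hk', by omega, ?_⟩
      have c1 : u' * x (a + N) = x (a + N) * u' :=
        Wd_comm x hC (by omega) hu' (x_mem_Wd x le_rfl (lt_add_one (a + (N : ℤ))))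
      rw [mul_assoc u' v, ← e, cc, hln]
      simp only [← mul_assoc]
      rw [c1]
end NF

end
end KeySupp
end LSS

namespace LSS
namespace KeySupp
noncomputable section

def DomOn (a b : ℤ) (μ : Ex) : Prop := ∀ i, a ≤ i → i < b → μ (i + 1) ≤ μ i

def Cone (a b : ℤ) : AddSubmonoid GR :=
  AddSubmonoid.closure {f | ∃ w ∈ Wd dm a b, ∃ μ, DomOn a b μ ∧ f = w (mon μ)}

def sh (v : Ex) : AddMonoid.End GR := opOf fun β => mon (β + v)

lemma sh_mon (v β : Ex) : sh v (mon β) = mon (β + v) := opOf_mon _ _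

lemma sh_mul (v v' : Ex) : sh v * sh v' = sh (v' + v) := by
  apply hom_ext
  intro β
  show sh v (sh v' (mon β)) = sh (v' + v) (mon β)
  rw [sh_mon, sh_mon, sh_mon, add_assoc]

lemma dm_mon (p : ℤ) (β : Ex) (h : β (p + 1) ≤ β p) : dm p (mon β) =
    ∑ t ∈ Finset.range ((β p - β (p + 1)).toNat + 1), mon (β - (t : ℤ) • rt p) := by
  rw [dm, opOf_mon, strg, if_pos h]
  congr 2
  omega

lemma sh_dm (v : Ex) (p : ℤ) (h : v p = 0) (h' : v (p + 1) = 0) : sh v * dm p = dm p * sh v := by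
  apply hom_ext
  intro β
  show sh v (dm p (mon β)) = dm p (sh v (mon β))
  rw [sh_mon, dm, opOf_mon, opOf_mon, strg, strg]
  simp only [Pi.add_apply, h, h', add_zero]
  split_ifs
  · rw [map_sum]
    refine Finset.sum_congr rfl fun t _ => ?_
    rw [sh_mon]; congr 1; abel
  · rw [map_neg, map_sum]
    congr 1
    refine Finset.sum_congr rfl fun t _ => ?_
    rw [sh_mon]; congr 1; abel

/-- the unit vector -/
def ev (k : ℤ) : Ex := Pi.single k 1

lemma ev_self (k : ℤ) : ev k k = 1 := by simp [ev]
lemma ev_ne (k i : ℤ) (h : i ≠ k) : ev k i = 0 := by simp [ev, h]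
lemma rt_eq (p : ℤ) : rt p = ev p - ev (p + 1) := by
  funext i
  by_cases h : i = p
  · subst h; simp [rt_self, ev_self, ev_ne]
  by_cases h' : i = p + 1
  · subst h'; simp [rt_succ, ev_self, ev_ne]
  simp [rt_other p i h h', ev_ne, h, h']

lemma end_add (x y : AddMonoid.End GR) (f : GR) : (x + y) f = x f + y f := rfl
lemma end_mul (x y : AddMonoid.End GR) (f : GR) : (x * y) f = x (y f) := rfl
lemma end_sum (s : Finset ℕ) (x : ℕ → AddMonoid.End GR) (f : GR) :
    (∑ u ∈ s, x u) f = ∑ u ∈ s, x u f := by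
  induction s using Finset.induction_on with
  | empty => rfl
  | insert a s h ih => rw [Finset.sum_insert h, Finset.sum_insert h, end_add, ih]

def PhS (k c : ℤ) (lam : Ex) : AddSubmonoid (AddMonoid.End GR) :=
  AddSubmonoid.closure {y | ∃ w ∈ Wd dm k c, ∃ v : Ex, (∀ i ≤ k, v i = 0) ∧
    (k + 1 ≤ c → v (k + 1) ≤ 0) ∧ DomOn (k + 1) c (lam + v) ∧ y = w * sh v}

lemma sum_ident {A : Type*} [AddCommMonoid A] (N P : ℕ) (F : ℕ → ℕ → A) :
    ∑ t ∈ Finset.range (N + 1), ∑ r ∈ Finset.range (t + 1 + P), F t r =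
    (∑ r ∈ Finset.range (N + 1), ∑ s ∈ Finset.range (N + 1 - r), F (r + s) r) +
    ∑ t ∈ Finset.range (N + 1), ∑ u ∈ Finset.range P, F t (t + 1 + u) := by
  have h1 : ∀ t, ∑ r ∈ Finset.range (t + 1 + P), F t r = (∑ r ∈ Finset.range (t + 1), F t r) +
      ∑ u ∈ Finset.range P, F t (t + 1 + u) := fun t => Finset.sum_range_add _ _ _
  simp only [h1, Finset.sum_add_distrib]
  congr 1
  have := Finset.sum_range_diag_flip (N + 1) (fun r s => F (r + s) r)
  rw [← this]
  refine Finset.sum_congr rfl fun t _ => Finset.sum_congr rfl fun r hr => ?_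
  rw [Finset.mem_range] at hr
  congr 1
  omega

lemma Phi (m : ℕ) : ∀ (k : ℤ) (lam : Ex), DomOn (k + 1) (k + m + 1) lam →
    ∃ Φ : ℕ → AddMonoid.End GR, (∀ r, Φ r ∈ PhS k (k + m) lam) ∧
    ∀ β : Ex, (∀ i, k < i → i ≤ k + m + 1 → β i = lam i) → lam (k + 1) ≤ β k →
      cc dm k (m + 1) (mon β) =
        ∑ r ∈ Finset.range ((β k - lam (k + 1)).toNat + 1), Φ r (mon (β - (r : ℤ) • ev k)) := by
  induction m with
  | zero =>
    intro k lam _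
    refine ⟨fun r => sh ((r : ℤ) • ev (k + 1)), ?_, ?_⟩
    · intro r
      apply AddSubmonoid.subset_closure
      refine ⟨1, one_mem _, _, ?_, ?_, ?_, (one_mul _).symm⟩
      · intro i hi
        simp [ev_ne (k + 1) i (by omega)]
      · intro h; push_cast at h; omega
      · intro i h1 h2; push_cast at h2; omega
    · intro β h1 h2
      have h3 := h1 (k + 1) (by omega) (by push_cast; omega)
      have : cc dm k (0 + 1) (mon β) = dm k (mon β) := by simp [cc]
      rw [this, dm_mon k β (by omega), h3]
      refine Finset.sum_congr rfl fun t _ => ?_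
      rw [sh_mon, rt_eq, smul_sub]
      congr 1; abel
  | succ m ih =>
    intro k lam hd
    push_cast at hd
    obtain ⟨Φ', hm', hΦ'⟩ := ih (k + 1) lam (by
      intro i h1 h2; exact hd i (by omega) (by omega))
    set P : ℕ := (lam (k + 1) - lam (k + 2)).toNat with hP
    have hlam : lam (k + 2) ≤ lam (k + 1) := by
      have := hd (k + 1) (by omega) (by omega)
      rwa [add_assoc] at this
    refine ⟨fun r => Φ' r * dm k + ∑ u ∈ Finset.range P,
      Φ' (r + 1 + u) * sh (-((u : ℤ) + 1) • ev (k + 1)), ?_, ?_⟩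
    · intro r
      apply add_mem
      · have := hm' r
        rw [PhS] at this
        generalize Φ' _ = z at this
        induction this using AddSubmonoid.closure_induction with
        | zero => rw [zero_mul]; exact zero_mem _
        | add x y _ _ hx hy => rw [add_mul]; exact add_mem hx hy
        | mem y hy =>
          obtain ⟨w, hw, v, hv, hv1, hv2, rfl⟩ := hy
          apply AddSubmonoid.subset_closure
          refine ⟨w * dm k, mul_mem (Wd_mono _ (by omega) (by push_cast; omega) hw)
            (x_mem_Wd _ le_rfl (by push_cast; omega)), v, fun i hi => hv i (by omega),
            fun _ => (hv (k + 1) le_rfl).le, ?_, ?_⟩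
          · intro i h1 h2
            push_cast at h2
            rcases eq_or_lt_of_le h1 with rfl | h1
            · have := hv1 (by omega)
              simp only [Pi.add_apply, hv (k + 1) le_rfl, add_assoc] at this ⊢
              norm_num at this ⊢
              omega
            · exact hv2 i (by omega) (by omega)
          · rw [mul_assoc, mul_assoc, sh_dm v k (hv k (by omega)) (hv (k + 1) le_rfl)]
      · apply sum_mem
        intro u hu
        rw [Finset.mem_range] at hu
        have := hm' (r + 1 + u)
        rw [PhS] at this
        generalize Φ' _ = z at this
        induction this using AddSubmonoid.closure_induction with
        | zero => rw [zero_mul]; exact zero_mem _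
        | add x y _ _ hx hy => rw [add_mul]; exact add_mem hx hy
        | mem y hy =>
          obtain ⟨w, hw, v, hv, hv1, hv2, rfl⟩ := hy
          apply AddSubmonoid.subset_closure
          refine ⟨w, (Wd_mono _ (by omega) (by push_cast; omega) hw), 
            -((u : ℤ) + 1) • ev (k + 1) + v, ?_, ?_, ?_, ?_⟩
          · intro i hi
            simp [hv i (by omega), ev_ne (k + 1) i (by omega)]
          · intro _
            simp only [Pi.add_apply, Pi.smul_apply, ev_self, hv (k + 1) le_rfl, smul_eq_mul]
            omega
          · intro i h1 h2
            push_cast at h2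
            rcases eq_or_lt_of_le h1 with rfl | h1
            · have := hv1 (by omega)
              simp only [Pi.add_apply, Pi.smul_apply, ev_self, hv (k + 1) le_rfl, smul_eq_mul,
                ev_ne (k + 1) (k + 1 + 1) (by omega)] at this ⊢
              rw [show k + 1 + 1 = k + 2 by ring] at this ⊢
              omega
            · have := hv2 i (by omega) (by omega)
              simpa [ev_ne (k + 1) (i + 1) (by omega), ev_ne (k + 1) i (by omega)] using this
          · rw [mul_assoc, sh_mul]
    · intro β h1 h2
      have h3 := h1 (k + 1) (by omega) (by push_cast; omega)
      have e1 : cc dm k (m + 1 + 1) (mon β) = cc dm (k + 1) (m + 1) (dm k (mon β)) := by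
        rw [cc_succ']; rfl
      rw [e1, dm_mon k β (by omega), map_sum, h3]
      set N : ℕ := (β k - lam (k + 1)).toNat with hN
      have e2 : ∀ t ∈ Finset.range (N + 1), cc dm (k + 1) (m + 1) (mon (β - (t : ℤ) • rt k)) =
          ∑ r ∈ Finset.range (t + 1 + P), Φ' r (mon (β - (t : ℤ) • rt k - (r : ℤ) • ev (k + 1))) := by
        intro t ht
        rw [hΦ']
        · congr 2
          simp only [Pi.sub_apply, Pi.smul_apply, rt_succ, h3, smul_eq_mul]
          rw [show k + 1 + 1 = k + 2 by ring]
          omega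
        · intro i hi hi'
          simp [rt_other k i (by omega) (by omega), h1 i (by omega) (by push_cast; omega)]
        · simp only [Pi.sub_apply, Pi.smul_apply, rt_succ, h3, smul_eq_mul]
          rw [show k + 1 + 1 = k + 2 by ring]
          omega
      rw [Finset.sum_congr rfl e2, sum_ident N P, ← Finset.sum_add_distrib]
      refine Finset.sum_congr rfl fun r hr => ?_
      rw [Finset.mem_range] at hr
      show _ = (Φ' r * dm k + ∑ u ∈ Finset.range P,
        Φ' (r + 1 + u) * sh (-((u : ℤ) + 1) • ev (k + 1))) (mon (β - (r : ℤ) • ev k))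
      rw [end_add, end_sum]
      congr 1
      · show _ = Φ' r (dm k (mon _))
        rw [dm_mon, map_sum]
        · have : (β - (r : ℤ) • ev k) k - (β - (r : ℤ) • ev k) (k + 1) = β k - lam (k + 1) - r := by
            simp [ev_self, ev_ne k (k + 1) (by omega), h3]; ring
          rw [this, show N + 1 - r = (β k - lam (k + 1) - r).toNat + 1 by omega]
          refine Finset.sum_congr rfl fun s _ => ?_
          congr 2
          push_cast
          rw [rt_eq]
          module
        · simp [ev_self, ev_ne k (k + 1) (by omega), h3]; omega
      · refine Finset.sum_congr rfl fun u _ => ?_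
        show _ = Φ' (r + 1 + u) (sh _ (mon _))
        rw [sh_mon]
        congr 2
        push_cast
        rw [rt_eq]
        module

lemma Cone_apply {a b : ℤ} {w : AddMonoid.End GR} (hw : w ∈ Wd dm a b) {f : GR}
    (hf : f ∈ Cone a b) : w f ∈ Cone a b := by
  rw [Cone] at hf
  induction hf using AddSubmonoid.closure_induction with
  | zero => rw [map_zero]; exact zero_mem _
  | add x y _ _ hx hy => rw [map_add]; exact add_mem hx hy
  | mem y hy =>
    obtain ⟨w', hw', μ, hμ, rfl⟩ := hy
    exact AddSubmonoid.subset_closure ⟨w * w', mul_mem hw hw', μ, hμ, rfl⟩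

lemma cc_Cone (a b k : ℤ) (m : ℕ) (hk : a ≤ k) (hb : k + m = b) (lam : Ex) (hl : DomOn a b lam) :
    cc dm k m (mon lam) ∈ Cone a (b - 1) := by
  rcases m with _ | m
  · exact AddSubmonoid.subset_closure ⟨1, one_mem _, lam, fun i h1 h2 => hl i h1 (by omega), rfl⟩
  push_cast at hb
  obtain ⟨Φ, h1, h2⟩ := Phi m k lam (fun i h1 h2 => hl i (by omega) (by omega))
  rw [h2 lam (fun _ _ _ => rfl) (hl k hk (by omega))]
  apply sum_mem
  intro r hr
  rw [Finset.mem_range] at hr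
  have hk1 := hl k hk (by omega)
  have := h1 r
  rw [show k + (m : ℤ) = b - 1 by omega] at this
  rw [PhS] at this
  generalize Φ r = z at this
  induction this using AddSubmonoid.closure_induction with
  | zero => exact zero_mem _
  | add x y _ _ hx hy => rw [end_add]; exact add_mem hx hy
  | mem y hy =>
    obtain ⟨w, hw, v, hv, hv1, hv2, rfl⟩ := hy
    show w (sh v (mon _)) ∈ _
    rw [sh_mon]
    apply AddSubmonoid.subset_closure
    refine ⟨w, Wd_mono _ hk le_rfl hw, _, ?_, rfl⟩
    intro i hi1 hi2
    have hli := hl i hi1 (by omega)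
    rcases lt_trichotomy i k with h | h | h
    · have := hv i (by omega)
      have := hv (i + 1) (by omega)
      by_cases h' : i + 1 = k
      · subst h'
        simp [ev_self, ev_ne (i + 1) i (by omega), *]; omega
      · simp [ev_ne k i (by omega), ev_ne k (i + 1) (by omega), *]
    · subst h
      have := hv i le_rfl
      have := hv1 (by omega)
      simp [ev_self, ev_ne i (i + 1) (by omega), *]; omega
    · have := hv2 i (by omega) (by omega)
      simpa [ev_ne k i (by omega), ev_ne k (i + 1) (by omega)] using this

lemma Cone_right (a b : ℤ) (h : a ≤ b) : Cone a b ≤ Cone a (b - 1) := by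
  rw [Cone, AddSubmonoid.closure_le]
  rintro _ ⟨w, hw, μ, hμ, rfl⟩
  obtain ⟨N, rfl⟩ : ∃ N : ℕ, b = a + N := ⟨(b - a).toNat, by omega⟩
  obtain ⟨u, hu, k, m, hk, hkm, rfl⟩ := normal_form dm dm_idem dm_comm dm_braid a N w hw
  exact Cone_apply hu (cc_Cone a _ k m hk hkm μ hμ)

/-- duality on exponents -/
def sgE (β : Ex) : Ex := fun i => - β (1 - i)
def sg : AddMonoid.End GR := opOf fun β => mon (sgE β)
lemma sg_mon (β : Ex) : sg (mon β) = mon (sgE β) := opOf_mon _ _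
lemma sgE_rt (p : ℤ) : sgE (rt p) = rt (-p) := by
  funext i
  simp only [sgE, rt]
  split_ifs <;> omega
lemma sgE_add (β γ : Ex) : sgE (β + γ) = sgE β + sgE γ := by
  funext i; simp [sgE]; ring
lemma sgE_smul (c : ℤ) (γ : Ex) : sgE (c • γ) = c • sgE γ := by
  funext i; simp [sgE]
lemma sgE_sub (β γ : Ex) : sgE (β - γ) = sgE β - sgE γ := by
  funext i; simp [sgE]; ring
lemma sgE_sgE (β : Ex) : sgE (sgE β) = β := by
  funext i; simp [sgE]
lemma sg_sg (f : GR) : sg (sg f) = f := by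
  have : sg * sg = 1 := by
    apply hom_ext
    intro β
    show sg (sg (mon β)) = mon β
    rw [sg_mon, sg_mon, sgE_sgE]
  exact DFunLike.congr_fun this f

lemma sg_dm (p : ℤ) (f : GR) : sg (dm p f) = dm (-p) (sg f) := by
  have : sg * dm p = dm (-p) * sg := by
    apply hom_ext
    intro β
    show sg (dm p (mon β)) = dm (-p) (sg (mon β))
    rw [sg_mon, dm, dm, opOf_mon, opOf_mon, strg, strg]
    have e1 : sgE β (-p) = - β (p + 1) := by simp [sgE]; congr 1; ring
    have e2 : sgE β (-p + 1) = - β p := by simp [sgE]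
    rw [e1, e2]
    simp only [neg_le_neg_iff]
    split_ifs
    · rw [map_sum, show - β (p + 1) - - β p + 1 = β p - β (p + 1) + 1 by ring]
      refine Finset.sum_congr rfl fun t _ => ?_
      rw [sg_mon, sgE_sub, sgE_smul, sgE_rt]
    · rw [map_neg, map_sum, show - β p - - β (p + 1) - 1 = β (p + 1) - β p - 1 by ring]
      congr 1
      refine Finset.sum_congr rfl fun t _ => ?_
      rw [sg_mon, sgE_add, sgE_smul, sgE_rt]
  exact DFunLike.congr_fun this f

lemma sg_Wd (a b : ℤ) (w : AddMonoid.End GR) (hw : w ∈ Wd dm a b) :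
    ∃ w' ∈ Wd dm (1 - b) (1 - a), ∀ f, sg (w f) = w' (sg f) := by
  rw [Wd] at hw
  induction hw using Submonoid.closure_induction with
  | mem y hy =>
    obtain ⟨p, h1, h2, rfl⟩ := hy
    exact ⟨dm (-p), x_mem_Wd _ (by omega) (by omega), sg_dm p⟩
  | one => exact ⟨1, one_mem _, fun f => rfl⟩
  | mul y z _ _ hy hz =>
    obtain ⟨y', hy', h1⟩ := hy
    obtain ⟨z', hz', h2⟩ := hz
    refine ⟨y' * z', mul_mem hy' hz', fun f => ?_⟩
    show sg (y (z f)) = y' (z' (sg f))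
    rw [h1, h2]

lemma sg_Cone (a b : ℤ) (f : GR) (hf : f ∈ Cone a b) : sg f ∈ Cone (1 - b) (1 - a) := by
  rw [Cone] at hf
  induction hf using AddSubmonoid.closure_induction with
  | zero => rw [map_zero]; exact zero_mem _
  | add x y _ _ hx hy => rw [map_add]; exact add_mem hx hy
  | mem y hy =>
    obtain ⟨w, hw, μ, hμ, rfl⟩ := hy
    obtain ⟨w', hw', h⟩ := sg_Wd a b w hw
    apply AddSubmonoid.subset_closure
    refine ⟨w', hw', sgE μ, ?_, by rw [h, sg_mon]⟩
    intro i h1 h2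
    have := hμ (-i) (by omega) (by omega)
    simp only [sgE]
    rw [show 1 - (i + 1) = -i by ring, show 1 - i = -i + 1 by ring]
    omega

lemma Cone_left (a b : ℤ) (h : a ≤ b) : Cone a b ≤ Cone (a + 1) b := by
  intro f hf
  have h1 := Cone_right (1 - b) (1 - a) (by omega) (sg_Cone a b f hf)
  have h2 := sg_Cone _ _ _ h1
  rw [sg_sg] at h2
  convert h2 using 2 <;> ring

lemma Cone_le (a b p : ℤ) (h : a ≤ p) (h' : p < b) : Cone a b ≤ Cone p (p + 1) := by
  have h1 : ∀ N : ℕ, Cone a (p + 1 + N) ≤ Cone a (p + 1) := by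
    intro N
    induction N with
    | zero => simp
    | succ N ih =>
      refine le_trans ?_ ih
      have := Cone_right a (p + 1 + (N + 1 : ℕ)) (by omega)
      convert this using 2
      push_cast; ring
  have h2 : ∀ N : ℕ, Cone (p - N) (p + 1) ≤ Cone p (p + 1) := by
    intro N
    induction N with
    | zero => simp
    | succ N ih =>
      refine le_trans ?_ ih
      have := Cone_left (p - (N + 1 : ℕ)) (p + 1) (by omega)
      convert this using 2
      push_cast; ring
  obtain ⟨N, rfl⟩ : ∃ N : ℕ, b = p + 1 + N := ⟨(b - p - 1).toNat, by omega⟩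
  obtain ⟨M, rfl⟩ : ∃ M : ℕ, a = p - M := ⟨(p - a).toNat, by omega⟩
  exact (h1 N).trans (h2 M)

end
end KeySupp
end LSS

namespace LSS
namespace KeySupp
noncomputable section

def GoodP (p : ℤ) (f : GR) : Prop := (∀ β, 0 ≤ f.coeff β) ∧ (∀ β, 0 ≤ (dm p f).coeff β) ∧
  ∀ β : Ex, 0 < (dm p f).coeff β ↔
    ∃ t : ℤ, 0 ≤ t ∧ β (p + 1) - β p ≤ t ∧ 0 < f.coeff (β + t • rt p)

lemma GoodP_add (p : ℤ) (f g : GR) (hf : GoodP p f) (hg : GoodP p g) : GoodP p (f + g) := by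
  obtain ⟨f1, f2, f3⟩ := hf
  obtain ⟨g1, g2, g3⟩ := hg
  have pos : ∀ x y : ℤ, 0 ≤ x → 0 ≤ y → (0 < x + y ↔ 0 < x ∨ 0 < y) := by omega
  refine ⟨fun β => ?_, fun β => ?_, fun β => ?_⟩
  · rw [AddMonoidAlgebra.coeff_add, Finsupp.add_apply]; exact add_nonneg (f1 β) (g1 β)
  · rw [map_add, AddMonoidAlgebra.coeff_add, Finsupp.add_apply]; exact add_nonneg (f2 β) (g2 β)
  · rw [map_add, AddMonoidAlgebra.coeff_add, Finsupp.add_apply, pos _ _ (f2 β) (g2 β), f3, g3]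
    simp only [AddMonoidAlgebra.coeff_add, Finsupp.add_apply, pos _ _ (f1 _) (g1 _)]
    constructor
    · rintro (⟨t, h1, h2, h3⟩ | ⟨t, h1, h2, h3⟩)
      · exact ⟨t, h1, h2, Or.inl h3⟩
      · exact ⟨t, h1, h2, Or.inr h3⟩
    · rintro ⟨t, h1, h2, h3 | h3⟩
      · exact Or.inl ⟨t, h1, h2, h3⟩
      · exact Or.inr ⟨t, h1, h2, h3⟩

lemma coeff_sum_mon (s : Finset ℕ) (g : ℕ → Ex) (β : Ex) :
    (∑ t ∈ s, mon (g t)).coeff β = ∑ t ∈ s, if g t = β then 1 else 0 := by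
  induction s using Finset.induction_on with
  | empty => simp
  | insert a s h ih =>
    rw [Finset.sum_insert h, Finset.sum_insert h, AddMonoidAlgebra.coeff_add, Finsupp.add_apply,
      mon_coeff, ih]

lemma dm_mon_coeff (p : ℤ) (μ : Ex) (h : μ (p + 1) ≤ μ p) (β : Ex) :
    0 ≤ (dm p (mon μ)).coeff β ∧ (0 < (dm p (mon μ)).coeff β ↔
      ∃ s : ℤ, 0 ≤ s ∧ s ≤ μ p - μ (p + 1) ∧ β = μ - s • rt p) := by
  rw [dm_mon p μ h, coeff_sum_mon]
  have hn : ∀ t ∈ Finset.range ((μ p - μ (p + 1)).toNat + 1),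
      (0 : ℤ) ≤ if μ - (t : ℤ) • rt p = β then 1 else 0 := by
    intro t _; split_ifs <;> simp
  refine ⟨Finset.sum_nonneg hn, ?_⟩
  rw [Finset.sum_pos_iff_of_nonneg hn]
  constructor
  · rintro ⟨t, ht, h1⟩
    rw [Finset.mem_range] at ht
    refine ⟨t, by omega, by omega, ?_⟩
    by_contra hne
    rw [if_neg (fun e => hne e.symm)] at h1
    exact absurd h1 (lt_irrefl _)
  · rintro ⟨s, h1, h2, rfl⟩
    refine ⟨s.toNat, Finset.mem_range.mpr (by omega), ?_⟩
    rw [Int.toNat_of_nonneg h1]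
    simp

lemma GoodP_mon (p : ℤ) (μ : Ex) (h : μ (p + 1) ≤ μ p) : GoodP p (mon μ) := by
  refine ⟨fun β => ?_, fun β => (dm_mon_coeff p μ h β).1, fun β => ?_⟩
  · rw [mon_coeff]; split_ifs <;> simp
  · rw [(dm_mon_coeff p μ h β).2]
    constructor
    · rintro ⟨s, h1, h2, rfl⟩
      refine ⟨s, h1, ?_, ?_⟩
      · simp [rt_self, rt_succ]; omega
      · rw [mon_coeff, if_pos (by abel)]; simp
    · rintro ⟨t, h1, h2, h3⟩
      rw [mon_coeff] at h3
      have e : μ = β + t • rt p := by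
        by_contra hne
        rw [if_neg hne] at h3; exact absurd h3 (lt_irrefl _)
      refine ⟨t, h1, ?_, by rw [e]; abel⟩
      rw [e]
      simp [rt_self, rt_succ]; omega

lemma GoodP_dm_mon (p : ℤ) (μ : Ex) (h : μ (p + 1) ≤ μ p) : GoodP p (dm p (mon μ)) := by
  have e : dm p (dm p (mon μ)) = dm p (mon μ) := DFunLike.congr_fun (dm_idem p) (mon μ)
  refine ⟨fun β => (dm_mon_coeff p μ h β).1, fun β => ?_, fun β => ?_⟩
  · rw [e]; exact (dm_mon_coeff p μ h β).1
  · rw [e, (dm_mon_coeff p μ h β).2]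
    simp only [(dm_mon_coeff p μ h _).2]
    constructor
    · rintro ⟨s, h1, h2, rfl⟩
      refine ⟨s, h1, ?_, 0, le_rfl, by omega, ?_⟩
      · simp [rt_self, rt_succ]; omega
      · simp
    · rintro ⟨t, h1, h2, s, h3, h4, h5⟩
      have e' : β = μ - (s + t) • rt p := by
        rw [eq_sub_of_add_eq h5, add_smul]; abel
      refine ⟨s + t, by omega, ?_, e'⟩
      rw [e'] at h2
      simp [rt_self, rt_succ] at h2; omega

lemma Wd_one (p : ℤ) (w : AddMonoid.End GR) (hw : w ∈ Wd dm p (p + 1)) : w = 1 ∨ w = dm p := by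
  rw [Wd] at hw
  induction hw using Submonoid.closure_induction with
  | mem y hy =>
    obtain ⟨q, h1, h2, rfl⟩ := hy
    right; congr 1; omega
  | one => left; rfl
  | mul y z _ _ hy hz =>
    rcases hy with rfl | rfl <;> rcases hz with rfl | rfl <;> simp [dm_idem]

lemma Cone_good (p : ℤ) (f : GR) (hf : f ∈ Cone p (p + 1)) : GoodP p f := by
  rw [Cone] at hf
  induction hf using AddSubmonoid.closure_induction with
  | zero => 
    refine ⟨fun β => ?_, fun β => ?_, fun β => ?_⟩ <;> simp
  | add x y _ _ hx hy => exact GoodP_add p x y hx hy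
  | mem y hy =>
    obtain ⟨w, hw, μ, hμ, rfl⟩ := hy
    have := hμ p le_rfl (by omega)
    rcases Wd_one p w hw with rfl | rfl
    · exact GoodP_mon p μ this
    · exact GoodP_dm_mon p μ this

def Sat (a b : ℤ) (A : Ex → Prop) : Prop := ∀ β, A β → ∀ i j d : ℤ, a ≤ i → i < j → j ≤ b →
  0 ≤ d → d ≤ β j - β i → A (β + d • (ev i - ev j))

lemma Sat.mv {a b : ℤ} {A : Ex → Prop} (h : Sat a b A) {β : Ex} (hβ : A β) (i j d : ℤ)
    (h1 : a ≤ i) (h2 : i < j) (h3 : j ≤ b) (h4 : 0 ≤ d) (h5 : d = 0 ∨ d ≤ β j - β i) :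
    A (β + d • (ev i - ev j)) := by
  rcases h5 with rfl | h5
  · simpa using hβ
  · exact h β hβ i j d h1 h2 h3 h4 h5

lemma ev_apply (k i : ℤ) : ev k i = if i = k then 1 else 0 := by
  split_ifs with h
  · subst h; exact ev_self i
  · exact ev_ne k i h

lemma Sat_hull (a b p : ℤ) (hp : a ≤ p) (hp' : p + 1 ≤ b) (A M : Ex → Prop) (hA : Sat a b A)
    (hM : ∀ β : Ex, M β ↔ ∃ t : ℤ, 0 ≤ t ∧ β (p + 1) - β p ≤ t ∧ A (β + t • rt p)) :
    Sat a b M := by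
  intro β hβ i j d hi hij hj hd hdj
  obtain ⟨t, ht, ht', hτ⟩ := (hM β).1 hβ
  rw [hM]
  simp only [rt_eq] at hτ ⊢
  have red : ∀ t' : ℤ, 0 ≤ t' → β (p + 1) + d * (ev i (p + 1) - ev j (p + 1)) 
      - (β p + d * (ev i p - ev j p)) ≤ t' →
      A (β + d • (ev i - ev j) + t' • (ev p - ev (p + 1))) →
      ∃ t : ℤ, 0 ≤ t ∧ (β + d • (ev i - ev j)) (p + 1) - (β + d • (ev i - ev j)) p ≤ t ∧ 
        A (β + d • (ev i - ev j) + t • (ev p - ev (p + 1))) := by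
    intro t' h1 h2 h3
    refine ⟨t', h1, ?_, h3⟩
    simpa using h2
  by_cases c1 : i = p
  · subst c1
    by_cases c2 : j = i + 1
    · subst c2
      refine red (t - d) (by omega) ?_ ?_
      · simp [ev_apply]; omega
      · convert hτ using 1; module
    · obtain ⟨e, he⟩ : ∃ e, e = max 0 (d - t) := ⟨_, rfl⟩
      have m1 := hA.mv hτ i j e hi hij hj (by omega) (by
        simp [ev_apply, hij.ne', c2]; omega)
      have m2 := hA.mv m1 (i + 1) j (d - e) (by omega) (by omega) hj (by omega) (by
        simp [ev_apply, hij.ne', c2, Ne.symm c2]; omega)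
      refine red (t + e - d) (by omega) ?_ ?_
      · simp [ev_apply, hij.ne, Ne.symm c2]; omega
      · convert m2 using 1; module
  by_cases c1' : i = p + 1
  · subst c1'
    obtain ⟨e, he⟩ : ∃ e, e = max 0 (β (p + 1) + d - (β p + t)) := ⟨_, rfl⟩
    have hjp : j ≠ p := by omega
    have m1 := hA.mv hτ p j e (by omega) (by omega) hj (by omega) (by
      simp [ev_apply, hij.ne', hjp]; omega)
    have m2 := hA.mv m1 (p + 1) j (d - e) (by omega) (by omega) hj (by omega) (by
      simp [ev_apply, hij.ne', hij.ne, hjp]; omega)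
    refine red (t + e) (by omega) ?_ ?_
    · simp [ev_apply, hij.ne, hjp.symm]; omega
    · convert m2 using 1; module
  by_cases c2 : j = p
  · subst c2
    obtain ⟨e, he⟩ : ∃ e, e = min d (β j + t - β (j + 1)) := ⟨_, rfl⟩
    have m1 := hA.mv hτ i (j + 1) (d - e) (by omega) (by omega) (by omega) (by omega) (by
      simp [ev_apply, c1, c1']; omega)
    have m2 := hA.mv m1 i j e (by omega) (by omega) hj (by omega) (by
      simp [ev_apply, c1, c1', Ne.symm c1]; omega)
    refine red (t + d - e) (by omega) ?_ ?_
    · simp [ev_apply, Ne.symm c1, Ne.symm c1']; omega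
    · convert m2 using 1; module
  by_cases c2' : j = p + 1
  · subst c2'
    obtain ⟨e, he⟩ : ∃ e, e = min d t := ⟨_, rfl⟩
    have m1 := hA.mv hτ i (p + 1) (d - e) (by omega) (by omega) (by omega) (by omega) (by
      simp [ev_apply, c1, c1']; omega)
    have m2 := hA.mv m1 i p e (by omega) (by omega) (by omega) (by omega) (by
      simp [ev_apply, c1, c1', Ne.symm c1]; omega)
    refine red (t - e) (by omega) ?_ ?_
    · simp [ev_apply, Ne.symm c1, Ne.symm c1']; omega
    · convert m2 using 1; module
  · have m1 := hA.mv hτ i j d hi hij hj hd (by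
      simp [ev_apply, c1, c1', c2, c2']; omega)
    refine red t ht ?_ ?_
    · simp [ev_apply, Ne.symm c1, Ne.symm c1', Ne.symm c2, Ne.symm c2']; omega
    · convert m1 using 1; module

/-- Main combinatorial statement on supports. -/
lemma supp_main (a b : ℤ) (lam : Ex) (hl : DomOn a b lam) (w : AddMonoid.End GR)
    (hw : w ∈ Wd dm a b) :
    Sat a b (fun β => 0 < (w (mon lam)).coeff β) := by
  rw [Wd] at hw
  induction hw using Submonoid.closure_induction_left with
  | one =>
    intro β hβ i j d hi hij hj hd hdj
    have e : lam = β := by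
      by_contra hne
      have : ((1 : AddMonoid.End GR) (mon lam)).coeff β = 0 := by
        show (mon lam).coeff β = 0
        rw [mon_coeff, if_neg hne]
      simp only [this] at hβ
      exact absurd hβ (lt_irrefl _)
    subst e
    have anti : ∀ N : ℕ, i + N ≤ b → lam (i + N) ≤ lam i := by
      intro N
      induction N with
      | zero => simp
      | succ N ih =>
        intro h
        push_cast at h ⊢
        have := hl (i + N) (by omega) (by omega)
        rw [add_assoc] at this
        exact this.trans (ih (by omega))
    have := anti (j - i).toNat (by omega)
    rw [show i + ((j - i).toNat : ℤ) = j by omega] at this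
    obtain rfl : d = 0 := by omega
    simpa using hβ
  | mul_left y hy w hw ih =>
    obtain ⟨p, h1, h2, rfl⟩ := hy
    have hc : w (mon lam) ∈ Cone a b := AddSubmonoid.subset_closure ⟨w, hw, lam, hl, rfl⟩
    have := Cone_good p _ (Cone_le a b p h1 h2 hc)
    exact Sat_hull a b p h1 (by omega) _ _ ih this.2.2

end
end KeySupp
end LSS

namespace LSS
namespace KeySupp
noncomputable section
open MvPolynomial

def ext (n : ℕ) (e : Fin n → ℕ) : Ex := fun i =>
  if h : 0 ≤ i ∧ i < n then (e ⟨i.toNat, by omega⟩ : ℤ) else 0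

lemma ext_apply (n : ℕ) (e : Fin n → ℕ) (i : Fin n) : ext n e (i.1 : ℤ) = e i := by
  have : (0 : ℤ) ≤ (i.1 : ℤ) ∧ (i.1 : ℤ) < n := by have := i.2; omega
  simp [ext]

lemma ext_out (n : ℕ) (e : Fin n → ℕ) (i : ℤ) (h : ¬ (0 ≤ i ∧ i < n)) : ext n e i = 0 := by
  simp only [ext, dif_neg h]

lemma ext_inj (n : ℕ) (e e' : Fin n → ℕ) (h : ext n e = ext n e') : e = e' := by
  funext i
  have := congrFun h (i.1 : ℤ)
  rw [ext_apply, ext_apply] at this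
  exact_mod_cast this

lemma Ex_ext (n : ℕ) (u v : Ex) (h1 : ∀ i : Fin n, u (i.1 : ℤ) = v (i.1 : ℤ))
    (h2 : ∀ i : ℤ, ¬ (0 ≤ i ∧ i < n) → u i = v i) : u = v := by
  funext i
  by_cases h : 0 ≤ i ∧ i < n
  · have := h1 ⟨i.toNat, by omega⟩
    simpa [Int.toNat_of_nonneg h.1] using this
  · exact h2 i h

lemma mon_zero : mon 0 = 1 := rfl

lemma mon_pow (v : Ex) (k : ℕ) : mon v ^ k = mon ((k : ℤ) • v) := by
  induction k with
  | zero => simp [mon_zero]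
  | succ k ih =>
    rw [pow_succ, ih, mon_mul]; congr 1; push_cast; module

lemma mon_prod {κ : Type*} (s : Finset κ) (g : κ → Ex) :
    ∏ i ∈ s, mon (g i) = mon (∑ i ∈ s, g i) := by
  induction s using Finset.induction_on with
  | empty => simp [mon_zero]
  | insert a s h ih => rw [Finset.prod_insert h, Finset.sum_insert h, ih, mon_mul]

lemma ext_sum (n : ℕ) (e : Fin n → ℕ) : ∑ i : Fin n, (e i : ℤ) • ev (i.1 : ℤ) = ext n e := by
  apply Ex_ext n
  · intro i
    rw [ext_apply, Finset.sum_apply, Finset.sum_eq_single i]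
    · simp [ev_self]
    · intro j _ hj
      have : (i.1 : ℤ) ≠ (j.1 : ℤ) := by
        intro h; exact hj (Fin.ext (by omega))
      simp [ev_ne _ _ this]
    · simp
  · intro i hi
    rw [ext_out n e i hi, Finset.sum_apply]
    apply Finset.sum_eq_zero
    intro j _
    have : i ≠ (j.1 : ℤ) := by have := j.2; omega
    simp [ev_ne _ _ this]

/-- Embedding of polynomials in the group ring. -/
def io (n : ℕ) : MvPolynomial (Fin n) ℤ →+* GR :=
  (aeval (R := ℤ) (fun i : Fin n => mon (ev (i.1 : ℤ)))).toRingHom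

lemma io_X (n : ℕ) (i : Fin n) : io n (X i) = mon (ev (i.1 : ℤ)) := by
  simp [io]

lemma io_monomial (n : ℕ) (e : Fin n →₀ ℕ) (c : ℤ) : io n (monomial e c) = c • mon (ext n e) := by
  have : io n (monomial e c) = aeval (R := ℤ) (fun i : Fin n => mon (ev (i.1 : ℤ))) (monomial e c) :=
    rfl
  rw [this, aeval_monomial, Finsupp.prod_fintype _ _ (by simp)]
  simp only [mon_pow]
  rw [mon_prod, ext_sum]
  simp [zsmul_eq_mul]

lemma io_coeff (n : ℕ) (f : MvPolynomial (Fin n) ℤ) (β : Fin n → ℕ) :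
    (io n f).coeff (ext n β) = coeffOf n β f := by
  induction f using MvPolynomial.induction_on' with
  | monomial e c =>
    rw [io_monomial, coeffOf, coeff_monomial, AddMonoidAlgebra.coeff_smul, Finsupp.smul_apply,
      mon_coeff]
    by_cases h : e = expOf n β
    · subst h
      simp [expOf]
    · have : ext n e ≠ ext n β := by
        intro h'
        apply h
        have := ext_inj n _ _ h'
        ext i
        simp [expOf, ← this]
      simp [h, this]
  | add f g hf hg =>
    rw [map_add, AddMonoidAlgebra.coeff_add, Finsupp.add_apply, hf, hg]
    simp [coeffOf]

lemma io_mono (n : ℕ) (β : Fin n → ℕ) : io n (mono n β) = mon (ext n β) := by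
  rw [mono, io_monomial, one_smul]
  rfl

lemma sw_io (n p : ℕ) (h : p + 1 < n) (f : MvPolynomial (Fin n) ℤ) :
    io n (rename (Equiv.swap (⟨p, by omega⟩ : Fin n) ⟨p + 1, h⟩) f) = sw p (io n f) := by
  have key : (io n).comp
      (rename (R := ℤ) (Equiv.swap (⟨p, by omega⟩ : Fin n) ⟨p + 1, h⟩)).toRingHom =
      (sw p).comp (io n) := by
    apply MvPolynomial.ringHom_ext
    · intro r
      simp
    · intro i
      show io n (rename _ (X i)) = sw p (io n (X i))
      rw [rename_X, io_X, io_X, sw_mon]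
      congr 1
      funext j
      simp only [swE, AddMonoidHom.coe_mk, ZeroHom.coe_mk, ev_apply, Equiv.swap_apply_def,
        Fin.ext_iff]
      by_cases h1 : i.1 = p
      · simp only [h1, if_true]
        split_ifs <;> push_cast at * <;> omega
      · by_cases h2 : i.1 = p + 1
        · simp only [h2, if_true, Nat.succ_ne_self, if_false]
          split_ifs <;> push_cast at * <;> omega
        · simp only [h1, h2, if_false]
          split_ifs <;> omega
  exact DFunLike.congr_fun key f

lemma dem_exists (n : ℕ) (a b : Fin n) (f : MvPolynomial (Fin n) ℤ) :
    ∃ g, (X a - X b) * g = X a * f - X b * rename (⇑(Equiv.swap a b)) f := by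
  have hd : (X a - X b : MvPolynomial (Fin n) ℤ) ∣ f - rename (⇑(Equiv.swap a b)) f := by
    rw [← Ideal.mem_span_singleton, ← Ideal.Quotient.eq]
    set I : Ideal (MvPolynomial (Fin n) ℤ) := Ideal.span {X a - X b} with hI
    have hab : Ideal.Quotient.mk I (X a) = Ideal.Quotient.mk I (X b) := by
      rw [Ideal.Quotient.eq]; exact Ideal.mem_span_singleton_self _
    have key : Ideal.Quotient.mk I = (Ideal.Quotient.mk I).comp
        (rename (R := ℤ) (⇑(Equiv.swap a b))).toRingHom := by
      apply MvPolynomial.ringHom_ext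
      · intro r; simp
      · intro i
        show Ideal.Quotient.mk I (X i) = Ideal.Quotient.mk I (rename _ (X i))
        rw [rename_X, Equiv.swap_apply_def]
        split_ifs with h1 h2
        · rw [h1, hab]
        · rw [h2, hab]
        · rfl
    exact DFunLike.congr_fun key f
  obtain ⟨g, hg⟩ := hd
  refine ⟨f + X b * g, ?_⟩
  linear_combination -(X b : MvPolynomial (Fin n) ℤ) * hg

lemma io_dem (n p : ℕ) (h : p + 1 < n) (f : MvPolynomial (Fin n) ℤ) :
    io n (dem n (p + 1) f) = dm p (io n f) := by
  have hg := dem_exists n ⟨p, by omega⟩ ⟨p + 1, h⟩ f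
  have e : dem n (p + 1) f = hg.choose := by
    rw [dem, dif_pos ⟨by omega, h⟩]
    exact dif_pos hg
  rw [e]
  have hs := hg.choose_spec
  generalize hg.choose = g at hs
  have hs' := congrArg (io n) hs
  rw [map_mul, map_sub, map_sub, map_mul, map_mul, sw_io n p h, io_X, io_X] at hs'
  apply dm_eq_of
  have h1 : mon (-ev (p : ℤ)) * mon (ev (p : ℤ)) = 1 := by
    rw [mul_comm]; exact mon_inv _
  have h2 : mon (-ev (p : ℤ)) * mon (ev ((p : ℤ) + 1)) = mon (-rt p) := by
    rw [mon_mul, rt_eq]; congr 1; abel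
  push_cast at hs'
  rw [← h2]
  linear_combination mon (-ev (p : ℤ)) * hs' - (io n g - io n f) * h1

def coinv (n : ℕ) (α : Fin n → ℕ) : Finset (Fin n × Fin n) :=
  Finset.univ.filter fun q => q.1 < q.2 ∧ α q.1 < α q.2

lemma swapAt_eq (n p : ℕ) (h : p + 1 < n) (α : Fin n → ℕ) (m : Fin n) :
    swapAt n p α m = α (Equiv.swap (⟨p, by omega⟩ : Fin n) ⟨p + 1, h⟩ m) := by
  rw [swapAt, Equiv.swap_apply_def]
  simp only [Fin.ext_iff]
  split_ifs
  · simp [ent, h]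
  · simp [ent, show p < n by omega]
  · rfl

lemma coinv_lt (n p : ℕ) (h : p + 1 < n) (α : Fin n → ℕ)
    (ha : α ⟨p, by omega⟩ < α ⟨p + 1, h⟩) : (coinv n (swapAt n p α)).card < (coinv n α).card := by
  set P : Fin n := ⟨p, by omega⟩ with hP
  set R : Fin n := ⟨p + 1, h⟩ with hR
  have hPR : P < R := by simp [hP, hR]
  have hmem : (P, R) ∈ coinv n α := by simp [coinv, hPR, ha]
  rw [← Finset.card_erase_add_one hmem, Nat.lt_succ_iff]
  apply Finset.card_le_card_of_injOn (fun q => (Equiv.swap P R q.1, Equiv.swap P R q.2))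
  · rintro ⟨x, y⟩ hq
    simp only [coinv, Finset.coe_filter, Finset.mem_univ, true_and, Set.mem_ofPred_eq,
      swapAt_eq n p h] at hq
    rw [← hP, ← hR] at hq
    obtain ⟨h1, h2⟩ := hq
    have hne : ¬ (x = P ∧ y = R) := by
      rintro ⟨rfl, rfl⟩
      simp at h2
      omega
    have hlt : Equiv.swap P R x < Equiv.swap P R y := by
      simp only [Equiv.swap_apply_def]
      have hP1 : P.1 = p := rfl
      have hR1 : R.1 = p + 1 := rfl
      simp only [Fin.ext_iff, Fin.lt_def] at h1 hne ⊢
      split_ifs <;> omega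
    simp only [Finset.coe_erase, Set.mem_sdiff, Finset.mem_coe, Set.mem_singleton_iff]
    refine ⟨by simp [coinv, h2, hlt], ?_⟩
    intro hh
    rw [Prod.mk.injEq] at hh
    have hx : x = R := by
      have := congrArg (Equiv.swap P R) hh.1
      simpa using this
    have hy : y = P := by
      have := congrArg (Equiv.swap P R) hh.2
      simpa using this
    rw [hx, hy] at h1
    exact absurd h1 (not_lt.mpr hPR.le)
  · rintro ⟨x, y⟩ _ ⟨x', y'⟩ _ hh
    simp only [Prod.mk.injEq, EmbeddingLike.apply_eq_iff_eq] at hh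
    rw [hh.1, hh.2]

lemma dom_of (n : ℕ) (α : Fin n → ℕ) (h : ¬ ∃ p : Fin n, ent n α p.1 < ent n α (p.1 + 1)) :
    DomOn 0 (n - 1) (ext n α) := by
  intro i h1 h2
  push Not at h
  have := h ⟨i.toNat, by omega⟩
  rw [ent, ent, dif_pos (by simp; omega), dif_pos (by simp; omega)] at this
  have e1 := ext_apply n α ⟨i.toNat, by omega⟩
  have e2 := ext_apply n α ⟨i.toNat + 1, by omega⟩
  have t1 : ((i.toNat : ℕ) : ℤ) = i := by omega
  push_cast at e1 e2
  rw [t1] at e1 e2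
  rw [e1, e2]
  exact_mod_cast this

lemma io_key (n k : ℕ) : ∀ α : Fin n → ℕ, (coinv n α).card ≤ k →
    ∃ w ∈ Wd dm 0 (n - 1 : ℤ), ∃ lam : Ex, DomOn 0 (n - 1) lam ∧
      io n (keyAux n k α) = w (mon lam) := by
  have asc : ∀ (α : Fin n → ℕ) (p : Fin n), ent n α p.1 < ent n α (p.1 + 1) →
      ∃ h : p.1 + 1 < n, α ⟨p.1, p.2⟩ < α ⟨p.1 + 1, h⟩ := by
    intro α p hp
    have h : p.1 + 1 < n := by
      by_contra hc
      rw [ent, ent, dif_neg hc] at hp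
      omega
    rw [ent, ent, dif_pos h, dif_pos p.2] at hp
    exact ⟨h, hp⟩
  induction k with
  | zero =>
    intro α hα
    refine ⟨1, one_mem _, ext n α, dom_of n α ?_, ?_⟩
    · rintro ⟨p, hp⟩
      obtain ⟨h, hlt⟩ := asc α p hp
      have := coinv_lt n p.1 h α hlt
      omega
    · rw [keyAux, io_mono]; rfl
  | succ k ih =>
    intro α hα
    rw [keyAux]
    split_ifs with hex
    · obtain ⟨h, hlt⟩ := asc α _ hex.choose_spec
      have hc := coinv_lt n _ h α hlt
      obtain ⟨w, hw, lam, hl, e⟩ := ih (swapAt n hex.choose.1 α) (by omega)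
      refine ⟨dm (hex.choose.1 : ℤ) * w, mul_mem (x_mem_Wd _ (by omega) (by omega)) hw, lam, hl, ?_⟩
      rw [io_dem n _ h, e]
      rfl
    · exact ⟨1, one_mem _, ext n α, dom_of n α hex, by rw [io_mono]; rfl⟩

end
end KeySupp
end LSS

namespace LSS

/-- Lemma 5.6: if `[x^β] κ_α > 0` and `β_i < β_j − (j−i)` for `i < j`,
then `[x^{t_{ij}β}] κ_α > 0`. -/
theorem stmt13 (n : ℕ) (α β : Fin n → ℕ) (hβ : 0 < coeffOf n β (keyPoly n α))
    (i j : Fin n) (hij : i < j) (hlt : (β i : ℤ) < (β j : ℤ) - gapZ n i j) :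
    0 < coeffOf n
      (fun m => if m = i then β j - (j.1 - i.1) else if m = j then β i + (j.1 - i.1) else β m)
      (keyPoly n α) := by
  have hc : (KeySupp.coinv n α).card ≤ n * n := by
    refine (Finset.card_filter_le _ _).trans ?_
    simp
  obtain ⟨w, hw, lam, hl, e⟩ := KeySupp.io_key n (n * n) α hc
  have hS := KeySupp.supp_main 0 (n - 1) lam hl w hw (KeySupp.ext n β) (by
    show 0 < (w (KeySupp.mon lam)).coeff _
    rw [← e, KeySupp.io_coeff]
    exact hβ) i.1 j.1 ((β j : ℤ) - ((j.1 : ℤ) - i.1) - β i)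
    (by omega) (by exact_mod_cast hij) (by have := j.2; omega)
    (by rw [gapZ] at hlt; omega)
    (by
      rw [KeySupp.ext_apply, KeySupp.ext_apply]
      have : i.1 < j.1 := hij
      omega)
  rw [← KeySupp.io_coeff]
  unfold keyPoly
  rw [e]
  have hij' : i.1 < j.1 := hij
  rw [gapZ] at hlt
  convert hS using 2
  apply KeySupp.Ex_ext n
  · intro m
    rw [KeySupp.ext_apply]
    simp only [Pi.add_apply, Pi.smul_apply, Pi.sub_apply, KeySupp.ext_apply, KeySupp.ev_apply,
      Fin.ext_iff, smul_eq_mul, Nat.cast_inj]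
    by_cases h1 : m.1 = i.1
    · have h2 : m.1 ≠ j.1 := by omega
      have h3 : m = i := Fin.ext h1
      subst h3
      simp [h2]; omega
    · by_cases h2 : m.1 = j.1
      · have h3 : m = j := Fin.ext h2
        subst h3
        simp [h1]; omega
      · simp [h1, h2]
  · intro m hm
    have h1 : m ≠ (i.1 : ℤ) := by have := i.2; omega
    have h2 : m ≠ (j.1 : ℤ) := by have := j.2; omega
    simp [KeySupp.ext_out _ _ m hm, KeySupp.ev_ne _ _ h1, KeySupp.ev_ne _ _ h2]

end LSS
end

section
/- Let c ∈ S_n be a standard Coxeter element of some parabolic subgroup and let λ be a partition with at most n parts. Then the composition cλ avoids each of the composition patterns 012, 1032, 0011, 0021, and 1022. -/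
open scoped Classical

namespace LSS

theorem st_val (n a : ℕ) (h1 : 0 < a) (h2 : a < n) (x : Fin n) :
    ((st n a x : Fin n) : ℕ) = if (x : ℕ) = a - 1 then a else if (x : ℕ) = a then a - 1 else x := by
  unfold st
  rw [dif_pos ⟨h1, h2⟩, Equiv.swap_apply_def]
  simp only [Fin.ext_iff]
  split_ifs <;> simp_all

/-- Invariants of a product of distinct simple transpositions. -/
theorem cox_inv (n : ℕ) (L : List ℕ) (hnd : L.Nodup) (hr : ∀ i ∈ L, 1 ≤ i ∧ i ≤ n - 1) :
    (∀ k, k ∉ L → ∀ x : Fin n, (x : ℕ) < k ↔ (((L.map (st n)).prod x : Fin n) : ℕ) < k) ∧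
    (∀ k, ∀ x y : Fin n, (x : ℕ) < k → (y : ℕ) < k → k ≤ ((L.map (st n)).prod x : Fin n).val →
      k ≤ ((L.map (st n)).prod y : Fin n).val → x = y) ∧
    (∀ k, ∀ x y : Fin n, k ≤ (x : ℕ) → k ≤ (y : ℕ) → ((L.map (st n)).prod x : Fin n).val < k →
      ((L.map (st n)).prod y : Fin n).val < k → x = y) ∧
    (∀ x : Fin n, (L.map (st n)).prod x = x → ∀ y : Fin n, y < x →
      (L.map (st n)).prod y < x) := by
  induction L with
  | nil =>
    refine ⟨by simp, ?_, ?_, by simp⟩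
    · intro k x y h1 h2 h3 h4
      simp at h3; omega
    · intro k x y h1 h2 h3 h4
      simp at h3; omega
  | cons a L ih =>
    obtain ⟨haL, hL⟩ := List.nodup_cons.mp hnd
    obtain ⟨i0, i1, i2, i3⟩ := ih hL (fun i hi => hr i (List.mem_cons_of_mem _ hi))
    have ha := hr a (List.mem_cons_self)
    have e : ∀ x : Fin n, ((((a :: L).map (st n)).prod x : Fin n) : ℕ) =
        if (((L.map (st n)).prod x : Fin n) : ℕ) = a - 1 then a else
        if (((L.map (st n)).prod x : Fin n) : ℕ) = a then a - 1 else
        (((L.map (st n)).prod x : Fin n) : ℕ) := by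
      intro x
      rw [List.map_cons, List.prod_cons, Equiv.Perm.mul_apply, st_val n a (by omega) (by omega)]
    have pa := i0 a haL
    have inj : ∀ x y : Fin n, (((L.map (st n)).prod x : Fin n) : ℕ) =
        (((L.map (st n)).prod y : Fin n) : ℕ) → x = y := fun x y h =>
      (L.map (st n)).prod.injective (Fin.ext h)
    simp only [Fin.lt_def, Fin.ext_iff (a := ((a :: L).map (st n)).prod _), e]
    simp only [Fin.lt_def, Fin.ext_iff (a := (L.map (st n)).prod _)] at i3
    generalize (L.map (st n)).prod = w at *
    refine ⟨?_, ?_, ?_, ?_⟩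
    · intro k hk x
      rw [List.mem_cons, not_or] at hk
      rw [i0 k hk.2 x]
      split_ifs <;> omega
    · intro k x y h1 h2 h3 h4
      have hx := pa x
      have hy := pa y
      by_cases hka : k = a
      · subst hka
        apply inj
        split_ifs at h3 h4 <;> omega
      · apply i1 k x y h1 h2
        · split_ifs at h3 <;> omega
        · split_ifs at h4 <;> omega
    · intro k x y h1 h2 h3 h4
      have hx := pa x
      have hy := pa y
      by_cases hka : k = a
      · subst hka
        apply inj
        split_ifs at h3 h4 <;> omega
      · apply i2 k x y h1 h2
        · split_ifs at h3 <;> omega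
        · split_ifs at h4 <;> omega
    · intro x hx y hy
      have hpx := pa x
      have hxx : (w x : ℕ) = x ∧ (x : ℕ) ≠ a ∧ (x : ℕ) ≠ a - 1 := by
        split_ifs at hx <;> omega
      have := i3 x hxx.1 y hy
      split_ifs <;> omega

theorem cox_no321 (n : ℕ) (c : Equiv.Perm (Fin n)) (hc : IsStdCox n c) (i j k : Fin n)
    (h1 : i < j) (h2 : j < k) (h3 : c⁻¹ j < c⁻¹ i) (h4 : c⁻¹ k < c⁻¹ j) : False := by
  obtain ⟨L, hL, hr, rfl⟩ := hc
  obtain ⟨-, i1, i2, i3⟩ := cox_inv n L hL hr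
  generalize (L.map (st n)).prod = c at *
  obtain ⟨x, rfl⟩ := c.surjective i
  obtain ⟨y, rfl⟩ := c.surjective j
  obtain ⟨z, rfl⟩ := c.surjective k
  simp only [Equiv.Perm.coe_inv, Equiv.symm_apply_apply] at h3 h4
  rcases lt_trichotomy (c y) y with h | h | h
  · have := i2 y x y (by omega) (by omega) (by omega) (by omega)
    omega
  · have := i3 y h z h4
    omega
  · have := i1 (c y) y z (by omega) (by omega) (by omega) (by omega)
    omega

theorem cox_no22 (n : ℕ) (c : Equiv.Perm (Fin n)) (hc : IsStdCox n c) (i j k l : Fin n)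
    (h1 : i < j) (h2 : j < k) (h3 : k < l) (h4 : c⁻¹ k < c⁻¹ i) (h5 : c⁻¹ k < c⁻¹ j)
    (h6 : c⁻¹ l < c⁻¹ i) (h7 : c⁻¹ l < c⁻¹ j) : False := by
  obtain ⟨L, hL, hr, rfl⟩ := hc
  obtain ⟨-, i1, i2, -⟩ := cox_inv n L hL hr
  generalize (L.map (st n)).prod = c at *
  obtain ⟨x, rfl⟩ := c.surjective i
  obtain ⟨y, rfl⟩ := c.surjective j
  obtain ⟨z, rfl⟩ := c.surjective k
  obtain ⟨t, rfl⟩ := c.surjective l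
  simp only [Equiv.Perm.coe_inv, Equiv.symm_apply_apply] at h4 h5 h6 h7
  by_cases h : min x.val y.val ≤ (c z).val
  · have := i1 (c z) z t (by omega) (by omega) (by omega) (by omega)
    subst this; omega
  · have := i2 (min x.val y.val) x y (by omega) (by omega) (by omega) (by omega)
    subst this; omega

theorem pact_lt (n : ℕ) (c : Equiv.Perm (Fin n)) (lam : Fin n → ℕ) (hlam : IsPartition n lam)
    (i j : Fin n) (h : ¬ pact n c lam j ≤ pact n c lam i) : c⁻¹ j < c⁻¹ i := by
  by_contra h'
  exact h (hlam _ _ (not_lt.mp h'))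

theorem no22_pat (n : ℕ) (c : Equiv.Perm (Fin n)) (hc : IsStdCox n c)
    (lam : Fin n → ℕ) (hlam : IsPartition n lam) (pat : Fin 4 → ℕ)
    (h02 : pat 0 < pat 2) (h03 : pat 0 < pat 3) (h12 : pat 1 < pat 2) (h13 : pat 1 < pat 3) :
    ¬ ContainsPat n (pact n c lam) pat := by
  rintro ⟨g, hg, hp, -⟩
  have key : ∀ s t, pat s < pat t → c⁻¹ (g t) < c⁻¹ (g s) := fun s t h =>
    pact_lt n c lam hlam _ _ (fun h' => absurd ((hp t s).mpr h') (by omega))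
  exact cox_no22 n c hc (g 0) (g 1) (g 2) (g 3) (hg (by decide)) (hg (by decide))
    (hg (by decide)) (key _ _ h02) (key _ _ h12) (key _ _ h03) (key _ _ h13)

/-- Lemma 6.3: for a standard Coxeter element `c` and partition `λ`,
the composition `cλ` avoids the composition patterns `012, 1032, 0011, 0021, 1022`. -/
theorem stmt15 (n : ℕ) (c : Equiv.Perm (Fin n)) (hc : IsStdCox n c)
    (lam : Fin n → ℕ) (hlam : IsPartition n lam) :
    ¬ ContainsPat n (pact n c lam) ![0, 1, 2] ∧
    ¬ ContainsPat n (pact n c lam) ![1, 0, 3, 2] ∧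
    ¬ ContainsPat n (pact n c lam) ![0, 0, 1, 1] ∧
    ¬ ContainsPat n (pact n c lam) ![0, 0, 2, 1] ∧
    ¬ ContainsPat n (pact n c lam) ![1, 0, 2, 2] := by
  refine ⟨?_, ?_, ?_, ?_, ?_⟩
  · rintro ⟨g, hg, hp, -⟩
    refine cox_no321 n c hc (g 0) (g 1) (g 2) (hg (by decide)) (hg (by decide))
      (pact_lt n c lam hlam _ _ fun h' => ?_) (pact_lt n c lam hlam _ _ fun h' => ?_)
    · exact absurd ((hp 1 0).mpr h') (by decide)
    · exact absurd ((hp 2 1).mpr h') (by decide)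
  all_goals
    apply no22_pat n c hc lam hlam <;> decide

end LSS
end

section
/- Fix D = {d_1 < … < d_k} ⊆ [n−1] with d_0 = 0, d_{k+1} = n and I = [n−1] ∖ D; let c ∈ S_n be a standard Coxeter element of some parabolic subgroup with ℓ(w_0(I)c) = ℓ(w_0(I)) + ℓ(c), and let λ be a partition with at most n parts. Let 1 ≤ i, j ≤ n and F ∈ Tab(cλ). Then: (i) wt(F)_m ≥ leftmin_{cλ}(i) for all 1 ≤ m ≤ i; (ii) wt(F)_m ≤ rightmax_{cλ}(j) for all j ≤ m ≤ n; (iii) if i < j are in the same block, leftmin_{cλ}(i) = (cλ)_i, and rightmax_{cλ}(j) = (cλ)_j, then wt(F)_i = (cλ)_i and wt(F)_j = (cλ)_j. -/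
open scoped Classical

namespace LSS


theorem aux_row (n : ℕ) (α : Fin n → ℕ) (F : ℕ → ℕ → ℕ) (hF : IsTab n α F) (i : Fin n)
    (r : ℕ) (hr : 1 ≤ r) (h : ∀ p : Fin n, p ≤ i → r ≤ α p) :
    ∀ c : ℕ, 1 ≤ c → c ≤ i.1 + 1 → InDiag n α c r ∧ F c r = c := by
  have hin : ∀ c : ℕ, 1 ≤ c → c ≤ i.1 + 1 → InDiag n α c r := by
    intro c h1 h2
    have hi := i.2
    refine ⟨h1, by omega, hr, ?_⟩
    have hc : c - 1 < n := by omega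
    rw [ent, dif_pos hc]
    apply h
    rw [Fin.le_def]
    show c - 1 ≤ i.1
    omega
  intro c
  induction c using Nat.strong_induction_on with
  | _ c ih =>
    intro h1 h2
    refine ⟨hin c h1 h2, ?_⟩
    obtain ⟨ha, hb⟩ := hF.1 c r (hin c h1 h2)
    by_contra hne
    have hlt : F c r < c := by omega
    obtain ⟨hd, he⟩ := ih (F c r) hlt ha (by omega)
    exact hF.2 c (F c r) r (hin c h1 h2) hd (by omega) he.symm

theorem leftmin_le (n : ℕ) (α : Fin n → ℕ) (i p : Fin n) (h : p ≤ i) :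
    leftmin n α i ≤ α p :=
  Nat.sInf_le ⟨p, h, rfl⟩

theorem le_leftmin (n : ℕ) (α : Fin n → ℕ) (i : Fin n) (x : ℕ) (h : ∀ p, p ≤ i → x ≤ α p) :
    x ≤ leftmin n α i := by
  unfold leftmin
  refine le_csInf ⟨_, i, le_refl i, rfl⟩ ?_
  rintro _ ⟨p, hp, rfl⟩
  exact h p hp

theorem part_one (n : ℕ) (α : Fin n → ℕ) (F : ℕ → ℕ → ℕ) (hF : IsTab n α F) (i m : Fin n)
    (hm : m ≤ i) : leftmin n α i ≤ wt n α F m := by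
  unfold wt
  calc leftmin n α i = (Finset.Icc 1 (leftmin n α i)).card := by simp
    _ ≤ _ := by
      apply Finset.card_le_card_of_injOn (fun r => (m.1 + 1, r))
      · intro r hr
        have hr' : 1 ≤ r ∧ r ≤ leftmin n α i := by simpa using hr
        have hm' : m.1 ≤ i.1 := hm
        obtain ⟨h1, h2⟩ := aux_row n α F hF i r hr'.1
          (fun p hp => hr'.2.trans (leftmin_le n α i p hp)) (m.1 + 1) (by omega) (by omega)
        have h3 : r ≤ Finset.univ.sup α :=
          hr'.2.trans ((leftmin_le n α i i le_rfl).trans (Finset.le_sup (Finset.mem_univ i)))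
        have := m.2
        rw [Finset.mem_coe, Finset.mem_filter, Finset.mem_product, Finset.mem_Icc, Finset.mem_Icc]
        exact ⟨⟨⟨Nat.succ_le_succ (Nat.zero_le _), this⟩, hr'.1, h3⟩, h1, h2⟩
      · intro a _ b _ hab
        exact (Prod.mk.inj hab).2

theorem part_two (n : ℕ) (α : Fin n → ℕ) (F : ℕ → ℕ → ℕ) (hF : IsTab n α F) (j m : Fin n)
    (hm : j ≤ m) : wt n α F m ≤ rightmax n α j := by
  unfold wt
  calc _ ≤ (Finset.Icc 1 (rightmax n α j)).card := by
        apply Finset.card_le_card_of_injOn (fun p => p.2)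
        · rintro ⟨a, r⟩ hp
          rw [Finset.mem_coe, Finset.mem_filter] at hp
          obtain ⟨-, hd, hf⟩ := hp
          simp only at hd hf
          have hle := (hF.1 a r hd).2
          obtain ⟨h1, h2, h3, h4⟩ := hd
          have hc : a - 1 < n := by omega
          rw [ent, dif_pos hc] at h4
          rw [Finset.mem_coe, Finset.mem_Icc]
          refine ⟨h3, h4.trans ?_⟩
          unfold rightmax
          apply Finset.le_sup (f := α)
          rw [Finset.mem_filter]
          refine ⟨Finset.mem_univ _, ?_⟩
          have hm' : j.1 ≤ m.1 := hm
          rw [Fin.le_def]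
          show j.1 ≤ a - 1
          omega
        · rintro ⟨a, r⟩ hp ⟨b, s⟩ hq hrs
          rw [Finset.mem_coe, Finset.mem_filter] at hp hq
          obtain ⟨-, hd, hf⟩ := hp
          obtain ⟨-, hd', hf'⟩ := hq
          simp only at hd hf hd' hf' hrs
          subst hrs
          by_contra hne
          have hab : a ≠ b := fun h => hne (by rw [h])
          exact hF.2 a b r hd hd' hab (by rw [hf, hf'])
    _ = _ := by simp

/-- A longest element inverts every adjacent pair of its parabolic. -/
theorem longest_inv (n : ℕ) (I : Set ℕ) (u : Equiv.Perm (Fin n)) (h0 : IsLongest n I u)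
    (a b : Fin n) (hab : b.1 = a.1 + 1) (hI : b.1 ∈ I) : u b < u a := by
  by_contra hcon
  have hne : a ≠ b := by intro h; rw [h] at hab; omega
  have hlt : u a < u b := lt_of_le_of_ne (not_lt.mp hcon) (fun h => hne (u.injective h))
  have hst : st n b.1 = Equiv.swap a b := by
    have hb := b.2
    rw [st, dif_pos ⟨by omega, b.2⟩]
    congr 1
    apply Fin.ext
    show b.1 - 1 = a.1
    omega
  have hmem : u * Equiv.swap a b ∈ parab n I := by
    apply Subgroup.mul_mem _ h0.1
    rw [← hst]
    exact Subgroup.subset_closure ⟨b.1, hI, rfl⟩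
  have hle := h0.2 _ hmem
  have : len n u < len n (u * Equiv.swap a b) := by
    unfold len
    rw [← Finset.card_image_of_injective (Finset.univ.filter fun p : Fin n × Fin n =>
      p.1 < p.2 ∧ u p.2 < u p.1)
      (f := Prod.map (Equiv.swap a b) (Equiv.swap a b))
      ((Equiv.swap a b).injective.prodMap (Equiv.swap a b).injective)]
    apply Finset.card_lt_card
    rw [Finset.ssubset_iff_of_subset]
    · refine ⟨(a, b), ?_, ?_⟩
      · have hab' : a < b := by rw [Fin.lt_def]; omega
        rw [Finset.mem_filter]
        exact ⟨Finset.mem_univ _, hab', by simpa using hlt⟩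
      · intro h
        rw [Finset.mem_image] at h
        obtain ⟨⟨x, y⟩, hxy, he⟩ := h
        rw [Finset.mem_filter] at hxy
        have h1 : Equiv.swap a b x = a := (Prod.mk.inj he).1
        have h2 : Equiv.swap a b y = b := (Prod.mk.inj he).2
        rw [Equiv.swap_apply_eq_iff, Equiv.swap_apply_left] at h1
        rw [Equiv.swap_apply_eq_iff, Equiv.swap_apply_right] at h2
        have h3 : x < y := hxy.2.1
        rw [h1, h2, Fin.lt_def] at h3
        omega
    · intro q hq
      rw [Finset.mem_image] at hq
      obtain ⟨⟨x, y⟩, hxy, rfl⟩ := hq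
      rw [Finset.mem_filter] at hxy ⊢
      obtain ⟨-, h1, h2⟩ := hxy
      simp only at h1 h2
      refine ⟨Finset.mem_univ _, ?_, by simpa using h2⟩
      simp only [Prod.map]
      have hnot : ¬ (x = a ∧ y = b) := by
        rintro ⟨rfl, rfl⟩
        exact absurd h2 (not_lt.mpr hlt.le)
      rw [Equiv.swap_apply_def, Equiv.swap_apply_def]
      simp only [Fin.ext_iff, Fin.lt_def] at *
      split_ifs <;> omega
  omega

theorem no_common (n : ℕ) (u c : Equiv.Perm (Fin n))
    (hlen : len n (u * c) = len n u + len n c) (a b : Fin n) (hab : a < b) (hu : u b < u a) :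
    c⁻¹ a < c⁻¹ b := by
  by_contra hcon
  have hsub : (Finset.univ.filter fun p : Fin n × Fin n => p.1 < p.2 ∧ (u * c) p.2 < (u * c) p.1)
      ⊆ (Finset.univ.filter fun p : Fin n × Fin n => p.1 < p.2 ∧ c p.2 < c p.1) ∪
        (((Finset.univ.filter fun p : Fin n × Fin n => p.1 < p.2 ∧ u p.2 < u p.1).erase
          (a, b)).image (Prod.map (c⁻¹ : Equiv.Perm (Fin n)) (c⁻¹ : Equiv.Perm (Fin n)))) := by
    rintro ⟨x, y⟩ h
    rw [Finset.mem_filter] at h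
    obtain ⟨-, h1, h2⟩ := h
    simp only [Equiv.Perm.mul_apply] at h1 h2
    rw [Finset.mem_union]
    by_cases hc : c y < c x
    · left
      rw [Finset.mem_filter]
      exact ⟨Finset.mem_univ _, h1, hc⟩
    · right
      rw [Finset.mem_image]
      refine ⟨(c x, c y), ?_, by simp⟩
      rw [Finset.mem_erase, Finset.mem_filter]
      have hne : c x ≠ c y := fun h => (ne_of_lt h1) (c.injective h)
      refine ⟨?_, Finset.mem_univ _, lt_of_le_of_ne (not_lt.mp hc) hne, h2⟩
      intro he
      have e1 : c x = a := (Prod.mk.inj he).1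
      have e2 : c y = b := (Prod.mk.inj he).2
      apply hcon
      rw [← e1, ← e2]
      simpa using h1
  have h1 := Finset.card_le_card hsub
  have h2 := h1.trans (Finset.card_union_le _ _)
  have hmem : (a, b) ∈ (Finset.univ.filter fun p : Fin n × Fin n => p.1 < p.2 ∧ u p.2 < u p.1) := by
    rw [Finset.mem_filter]
    exact ⟨Finset.mem_univ _, hab, hu⟩
  have h3 := Finset.card_erase_lt_of_mem hmem
  have h4 := h2.trans (Nat.add_le_add_left Finset.card_image_le _)
  unfold len at hlen
  omega

theorem block_anti (n k : ℕ) (d : Fin (k + 2) → ℕ) (hd : BlockData n k d)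
    (c w0I : Equiv.Perm (Fin n))
    (h0 : IsLongest n (Iset n k d) w0I)
    (hlen : len n (w0I * c) = len n w0I + len n c)
    (lam : Fin n → ℕ) (hlam : IsPartition n lam) (t : Fin (k + 1)) (e : ℕ) :
    ∀ p q : Fin n, d t.castSucc ≤ p.1 → q.1 = p.1 + e → q.1 < d t.succ →
      pact n c lam q ≤ pact n c lam p := by
  induction e with
  | zero =>
    intro p q _ hq _
    have : q = p := Fin.ext hq
    rw [this]
  | succ e ih =>
    intro p q h1 h2 h3
    have hq := q.2
    let q' : Fin n := ⟨p.1 + e, by omega⟩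
    have hq' : q'.1 = p.1 + e := rfl
    refine le_trans ?_ (ih p q' h1 rfl (by omega))
    have hI : q.1 ∈ Iset n k d := by
      refine ⟨by omega, by omega, ?_⟩
      rintro ⟨s, -, -, hs⟩
      have hA : t.castSucc < s := by
        rw [← hd.2.2.lt_iff_lt]; omega
      have hB : s < t.succ := by
        rw [← hd.2.2.lt_iff_lt]; omega
      rw [Fin.lt_def] at hA hB
      simp at hA hB
      omega
    have hu := longest_inv n _ w0I h0 q' q (by omega) hI
    have hlt := no_common n w0I c hlen q' q (by rw [Fin.lt_def]; omega) hu
    exact hlam _ _ hlt.le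

/-- Lemma 6.5: bounds on weights of flagged row-distinct fillings of
`D(cλ)` via `leftmin` and `rightmax`. -/
theorem stmt16 (n k : ℕ) (d : Fin (k + 2) → ℕ) (hd : BlockData n k d)
    (c w0I : Equiv.Perm (Fin n)) (hc : IsStdCox n c)
    (h0 : IsLongest n (Iset n k d) w0I)
    (hlen : len n (w0I * c) = len n w0I + len n c)
    (lam : Fin n → ℕ) (hlam : IsPartition n lam)
    (i j : Fin n) (F : ℕ → ℕ → ℕ) (hF : IsTab n (pact n c lam) F) :
    (∀ m : Fin n, m ≤ i → leftmin n (pact n c lam) i ≤ wt n (pact n c lam) F m) ∧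
    (∀ m : Fin n, j ≤ m → wt n (pact n c lam) F m ≤ rightmax n (pact n c lam) j) ∧
    (i < j → SameBlock n k d i j →
      leftmin n (pact n c lam) i = pact n c lam i →
      rightmax n (pact n c lam) j = pact n c lam j →
      wt n (pact n c lam) F i = pact n c lam i ∧
        wt n (pact n c lam) F j = pact n c lam j) := by
  refine ⟨fun m hm => part_one n _ F hF i m hm, fun m hm => part_two n _ F hF j m hm, ?_⟩
  rintro hij ⟨t, ht1, ht2, ht3, ht4⟩ hl hr
  have hij' : i.1 < j.1 := hij
  have hanti : ∀ p q : Fin n, i ≤ p → p ≤ q → q ≤ j →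
      pact n c lam q ≤ pact n c lam p := by
    intro p q hp hpq hq
    rw [Fin.le_def] at hp hpq hq
    exact block_anti n k d hd c w0I h0 hlen lam hlam t (q.1 - p.1) p q (by omega) (by omega)
      (by omega)
  have hleft : ∀ p, p ≤ i → pact n c lam i ≤ pact n c lam p := by
    intro p hp
    rw [← hl]
    exact leftmin_le n _ i p hp
  have hright : ∀ p, j ≤ p → pact n c lam p ≤ pact n c lam j := by
    intro p hp
    rw [← hr]
    apply Finset.le_sup (f := pact n c lam)
    rw [Finset.mem_filter]
    exact ⟨Finset.mem_univ _, hp⟩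
  have hji := hanti i j le_rfl hij.le le_rfl
  constructor
  · apply le_antisymm
    · refine (part_two n _ F hF i i le_rfl).trans ?_
      apply Finset.sup_le
      intro p hp
      rw [Finset.mem_filter] at hp
      rcases le_total p j with h | h
      · exact hanti i p le_rfl hp.2 h
      · exact (hright p h).trans hji
    · rw [← hl]
      exact part_one n _ F hF i i le_rfl
  · apply le_antisymm
    · rw [← hr]
      exact part_two n _ F hF j j le_rfl
    · refine le_trans ?_ (part_one n _ F hF j j le_rfl)
      apply le_leftmin
      intro p hp
      rcases le_total p i with h | h
      · exact hji.trans (hleft p h)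
      · exact hanti p j h hp le_rfl

end LSS
end
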